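/- Let K=K(c_1,c_2,c_1) be a symmetric A_3-crystal and v a self-complementary vertex. Let a,b in Z^3 with 0<=a,b<=c be such that v belongs to the upper subcrystal K^up[a] and to the lower subcrystal K^low[b]; let P be the middle subcrystal (a maximal path of color 2) containing v, let D=(D_1,D_2) be the deviation of the unique vertex of P lying in Pi^up[a], and let N=(N_2,N_3) be the deviation of the unique vertex of P lying in Pi^low[b]. Then: (i) (b_1,b_2,b_3)=(a_3,a_2,a_1); (ii) K^low[b] is the image of K^up[a] under sigma; (iii) D_1=-D_2=N_3=-N_2; (iv) v^up[a|D]=v^low[b|N]. -/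

import Mathlib

open Classical

noncomputable section

/-- Iterate a partial operator `k` times. -/
def optIter {V : Type} (f : V → Option V) : ℕ → V → Option V
  | 0, v => some v
  | k + 1, v => (f v).bind (optIter f k)

/-- A vertex type together with, for every natural number (color) `i`,
a partial operator whose graph is the set of `i`-edges. -/
structure PreGraph where
  V : Type
  F : ℕ → V → Option V

namespace PreGraph

/-- Partial inverse operator of color `i`. -/
def Finv (K : PreGraph) (i : ℕ) (v : K.V) : Option K.V :=
  if h : ∃ u, K.F i u = some v then some h.choose else none

/-- Number of edges of the maximal `i`-colored path beginning at `v`. -/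
def h (K : PreGraph) (i : ℕ) (v : K.V) : ℕ :=
  sSup {k | (optIter (K.F i) k v).isSome = true}

/-- Number of edges of the maximal `i`-colored path ending at `v`. -/
def t (K : PreGraph) (i : ℕ) (v : K.V) : ℕ :=
  sSup {k | ∃ u, optIter (K.F i) k u = some v}

/-- One (undirected) step along an edge of any color. -/
def Step (K : PreGraph) (u v : K.V) : Prop :=
  ∃ i, K.F i u = some v ∨ K.F i v = some u

/-- Weak connectivity. -/
def Connected (K : PreGraph) : Prop :=
  ∀ u v : K.V, Relation.ReflTransGen K.Step u v

/-- All edges have colors in `C`. -/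
def ColorsIn (K : PreGraph) (C : Set ℕ) : Prop :=
  ∀ i ∉ C, ∀ v, K.F i v = none

end PreGraph

/-- `s` has no incoming edges. -/
def IsSource (K : PreGraph) (s : K.V) : Prop := ∀ i u, K.F i u ≠ some s

/-- `tv` has no outgoing edges. -/
def IsSink (K : PreGraph) (tv : K.V) : Prop := ∀ i, K.F i tv = none

/-- `K` is a (finite) colored graph with colors in `C` satisfying axiom (A1):
every connected monochromatic subgraph is a finite directed path. -/
def IsColored (K : PreGraph) (C : Set ℕ) : Prop :=
  Finite K.V ∧ K.ColorsIn C ∧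
  (∀ (i : ℕ) (u u' v : K.V), K.F i u = some v → K.F i u' = some v → u = u') ∧
  (∀ (i : ℕ) (v : K.V) (k : ℕ), 0 < k → optIter (K.F i) k v ≠ some v)

/-- `|i - j| = 1`. -/
def Neighb (i j : ℕ) : Prop := i + 1 = j ∨ j + 1 = i

/-- `|i - j| ≥ 2`. -/
def Far (i j : ℕ) : Prop := i + 2 ≤ j ∨ j + 2 ≤ i

instance (i j : ℕ) : Decidable (Neighb i j) := by unfold Neighb; infer_instance
instance (i j : ℕ) : Decidable (Far i j) := by unfold Far; infer_instance

/-- Axiom (A2) for the ordered pair of distinct colors `(i, j)`. -/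
def A2at (K : PreGraph) (i j : ℕ) : Prop :=
  (∀ u v, K.F i u = some v →
    K.t j v ≤ K.t j u ∧ K.h j u ≤ K.h j v ∧
    ((K.h j u : ℤ) - (K.t j u : ℤ)) - ((K.h j v : ℤ) - (K.t j v : ℤ)) =
      (if Neighb i j then (-1 : ℤ) else 0)) ∧
  (∀ u v w, K.F i u = some v → K.F i v = some w →
    2 * K.h j v ≤ K.h j u + K.h j w)

/-- Axiom (A3) for neighboring colors `i, j`. -/
def A3at (K : PreGraph) (i j : ℕ) : Prop :=
  (∀ u v v', K.F i u = some v → K.F j u = some v' →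
    K.h j v = K.h j u →
    ((K.h i v' : ℤ) - (K.h i u : ℤ) = 1 ∧ ∃ w, K.F j v = some w ∧ K.F i v' = some w)) ∧
  (∀ u u' v, K.F i u = some v → K.F j u' = some v →
    (K.h j v : ℤ) - (K.h j u : ℤ) = 1 →
    (K.h i v = K.h i u' ∧ ∃ w, K.F j w = some u ∧ K.F i w = some u'))

/-- Axiom (A4) (Verma relations) for neighboring colors `i, j`. -/
def A4at (K : PreGraph) (i j : ℕ) : Prop :=
  (∀ u v v', K.F i u = some v → K.F j u = some v' →
    (K.h j v : ℤ) - (K.h j u : ℤ) = 1 → (K.h i v' : ℤ) - (K.h i u : ℤ) = 1 →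
    ∃ w, (((K.F i u).bind (K.F j)).bind (K.F j)).bind (K.F i) = some w ∧
         (((K.F j u).bind (K.F i)).bind (K.F i)).bind (K.F j) = some w) ∧
  (∀ u u' v, K.F i u = some v → K.F j u' = some v →
    K.h j v = K.h j u → K.h i v = K.h i u' →
    ∃ w, (((K.Finv i v).bind (K.Finv j)).bind (K.Finv j)).bind (K.Finv i) = some w ∧
         (((K.Finv j v).bind (K.Finv i)).bind (K.Finv i)).bind (K.Finv j) = some w)

/-- Axiom (A5) for colors `i, j` at distance at least 2. -/
def A5at (K : PreGraph) (i j : ℕ) : Prop :=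
  ∀ Fi ∈ ({K.F i, K.Finv i} : Set (K.V → Option K.V)),
  ∀ Fj ∈ ({K.F j, K.Finv j} : Set (K.V → Option K.V)),
  ∀ v, (Fi v).isSome → (Fj v).isSome →
    ∃ w, (Fi v).bind Fj = some w ∧ (Fj v).bind Fi = some w

/-- `K` is a regular crystal of type A on the color set `C`
(an `A_{|C|}`-crystal when `C` is an integer interval). -/
def IsCrystalOn (K : PreGraph) (C : Set ℕ) : Prop :=
  IsColored K C ∧ K.Connected ∧
  (∀ i ∈ C, ∀ j ∈ C, i ≠ j → A2at K i j) ∧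
  (∀ i ∈ C, ∀ j ∈ C, Neighb i j → A3at K i j ∧ A4at K i j) ∧
  (∀ i ∈ C, ∀ j ∈ C, Far i j → A5at K i j)

/-- `K` is an `A_n`-crystal (colors `1, …, n`). -/
def IsACrystal (n : ℕ) (K : PreGraph) : Prop := IsCrystalOn K (Set.Icc 1 n)

/-- Apply a list of operators, head first. -/
def applyStr (K : PreGraph) : List ℕ → K.V → Option K.V
  | [], v => some v
  | i :: L, v => (K.F i v).bind (applyStr K L)

/-- The string `w_{m,k,j} = F_{o+j} F_{o+j+1} ⋯ F_{o+j+k-1}` (rightmost applied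
first, i.e. head of the list applied first) for a crystal with colors `o+1, …, o+m`. -/
def wStr (o k j : ℕ) : List ℕ := (List.range k).map (fun m => o + j + k - 1 - m)

/-- The string `S_{m,k} = w_{m,k,m-k+1} ⋯ w_{m,k,2} w_{m,k,1}` for a crystal with
colors `o+1, …, o+m`. -/
def SStr (o m k : ℕ) : List ℕ :=
  (List.range (m - k + 1)).flatMap fun jm => wStr o k (jm + 1)

/-- The string `S_{m,m}^{a_{o+m}} ⋯ S_{m,1}^{a_{o+1}}` for a crystal with colors
`o+1, …, o+m`, defining the principal vertex with coordinates `a`. -/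
def prinStr (o m : ℕ) (a : ℕ → ℕ) : List ℕ :=
  (List.range m).flatMap fun km => (List.replicate (a (o + km + 1)) (SStr o m (km + 1))).flatten

def prinOpt (K : PreGraph) (o m : ℕ) (s : K.V) (a : ℕ → ℕ) : Option K.V :=
  applyStr K (prinStr o m a) s

/-- `p` is the principal vertex with coordinates `a` of the crystal `K` with colors
`o+1, …, o+m` and source `s`. -/
def IsPrin (K : PreGraph) (o m : ℕ) (s : K.V) (a : ℕ → ℕ) (p : K.V) : Prop :=
  prinOpt K o m s a = some p

/-- The principal lattice of an `A_n`-crystal with source `s` and parameter `c`. -/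
def PrinLat (K : PreGraph) (n : ℕ) (s : K.V) (c : ℕ → ℕ) : Set K.V :=
  {p | ∃ a : ℕ → ℕ, (∀ i, 1 ≤ i → i ≤ n → a i ≤ c i) ∧ IsPrin K 0 n s a p}

/-- One undirected step along an edge with color in `I`. -/
def stepOn (K : PreGraph) (I : Set ℕ) (u v : K.V) : Prop :=
  ∃ i ∈ I, K.F i u = some v ∨ K.F i v = some u

/-- `u` lies in the same `I`-colored component as `v`. -/
def inComp (K : PreGraph) (I : Set ℕ) (v u : K.V) : Prop :=
  Relation.ReflTransGen (stepOn K I) v u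

/-- The subcrystal of `K` with color set `I` containing `v` (the maximal connected
subgraph through `v` using only colors in `I`). -/
def PreGraph.sub (K : PreGraph) (I : Set ℕ) (v : K.V) : PreGraph where
  V := {u : K.V // inComp K I v u}
  F := fun i u =>
    if hi : i ∈ I then
      (K.F i u.1).pbind fun w hw =>
        some ⟨w, Relation.ReflTransGen.tail u.2 ⟨i, hi, Or.inl (Option.mem_def.mp hw)⟩⟩
    else none

/-- Directed reachability. -/
def dirReach (K : PreGraph) (u v : K.V) : Prop :=
  Relation.ReflTransGen (fun a b => ∃ i, K.F i a = some b) u v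

/-- The interval of `K` from `p` to `q`: the subgraph formed by all vertices and
edges lying on directed paths from `p` to `q`. -/
def PreGraph.interval (K : PreGraph) (p q : K.V) : PreGraph where
  V := {w : K.V // dirReach K p w ∧ dirReach K w q}
  F := fun i u =>
    (K.F i u.1).pbind fun w _ =>
      if hw : dirReach K p w ∧ dirReach K w q then some ⟨w, hw⟩ else none

/-- The symmetric extract: restriction to self-complementary vertices,
with `ibar`-edges given by `chain i`. -/
def extract (K : PreGraph) (chain : ℕ → K.V → Option K.V) (σ : K.V → K.V) : PreGraph where
  V := {v : K.V // σ v = v}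
  F := fun i u =>
    (chain i u.1).pbind fun w _ => if hw : σ w = w then some ⟨w, hw⟩ else none

/-- The operator chain for the color `ibar` of the symmetric extract of a
symmetric `A_{2n-1}`-crystal. -/
def chainB (K : PreGraph) (n : ℕ) (i : ℕ) (u : K.V) : Option K.V :=
  if 1 ≤ i ∧ i ≤ n then
    (if i = n then K.F n u else (K.F i u).bind (K.F (2 * n - i)))
  else none

/-- The operator chain for the color `ibar` of the symmetric extract of a
symmetric `A_{2n}`-crystal. -/
def chainC (K : PreGraph) (n : ℕ) (i : ℕ) (u : K.V) : Option K.V :=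
  if 1 ≤ i ∧ i ≤ n then
    (if i = n then (((K.F n u).bind (K.F (n + 1))).bind (K.F (n + 1))).bind (K.F n)
     else (K.F i u).bind (K.F (2 * n + 1 - i)))
  else none

/-- Symmetric extract from a symmetric `A_{2n-1}`-crystal. -/
def extractB (K : PreGraph) (n : ℕ) (σ : K.V → K.V) : PreGraph := extract K (chainB K n) σ

/-- Symmetric extract from a symmetric `A_{2n}`-crystal. -/
def extractC (K : PreGraph) (n : ℕ) (σ : K.V → K.V) : PreGraph := extract K (chainC K n) σ

/-- Admissibility of a six-tuple `(x', y, x''; y', x, y'')` in the worm model. -/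
def WormOK (g1 g2 : ℕ) : ℤ × ℤ × ℤ × ℤ × ℤ × ℤ → Prop
  | (x', y, x'', y', x, y'') =>
    (0 ≤ x' ∧ x' ≤ 2 * (g1 : ℤ)) ∧ (0 ≤ x'' ∧ x'' ≤ 2 * (g1 : ℤ)) ∧
    (0 ≤ x ∧ x ≤ 2 * (g1 : ℤ)) ∧
    (0 ≤ y' ∧ y' ≤ (g2 : ℤ)) ∧ (0 ≤ y'' ∧ y'' ≤ (g2 : ℤ)) ∧ (0 ≤ y ∧ y ≤ (g2 : ℤ)) ∧
    (2 ∣ x') ∧ (2 ∣ x'') ∧ (y' ≤ y ∧ y ≤ y'') ∧ (x' ≤ x ∧ x ≤ x'') ∧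
    (y' < y → x' = x) ∧ (y < y'' → x = x'')

/-- The candidate image of a worm under the operator `1tilde`. -/
def worm1 : ℤ × ℤ × ℤ × ℤ × ℤ × ℤ → ℤ × ℤ × ℤ × ℤ × ℤ × ℤ
  | (x', y, x'', y', x, y'') =>
    if 2 * x > x' + x'' then (x' + 2, y, x'', y', x, y'')
    else if x = x' ∧ x' = x'' ∧ y < y'' then (x', y + 1, x'', y', x, y'')
    else (x', y, x'' + 2, y', x, y'')

/-- The candidate image of a worm under the operator `2tilde`. -/
def worm2 : ℤ × ℤ × ℤ × ℤ × ℤ × ℤ → ℤ × ℤ × ℤ × ℤ × ℤ × ℤ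
  | (x', y, x'', y', x, y'') =>
    if 2 * y > y' + y'' then (x', y, x'', y' + 1, x, y'')
    else if y' = y ∧ y = y'' ∧ x < x'' then (x', y, x'', y', x + 1, y'')
    else (x', y, x'', y', x, y'' + 1)

/-- The worm graph `W(g1, g2)`, with colors `1 = 1tilde` and `2 = 2tilde`. -/
def WormGraph (g1 g2 : ℕ) : PreGraph where
  V := {w : ℤ × ℤ × ℤ × ℤ × ℤ × ℤ // WormOK g1 g2 w}
  F := fun i u =>
    if i = 1 then
      (if h1 : WormOK g1 g2 (worm1 u.1) then some ⟨worm1 u.1, h1⟩ else none)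
    else if i = 2 then
      (if h2 : WormOK g1 g2 (worm2 u.1) then some ⟨worm2 u.1, h2⟩ else none)
    else none

/-- Isomorphism of colored graphs, renaming colors via `φ`. -/
def IsoVia (K L : PreGraph) (φ : ℕ → ℕ) : Prop :=
  ∃ e : K.V ≃ L.V, ∀ i u v, K.F i u = some v ↔ L.F (φ i) (e u) = some (e v)

/-- The Cartesian product of an `i`-path of length `p` and a `j`-path of length `q`. -/
def boxGraph (i j p q : ℕ) : PreGraph where
  V := Fin (p + 1) × Fin (q + 1)
  F := fun s u =>
    if s = i then
      (if h : (u.1 : ℕ) < p then some (⟨(u.1 : ℕ) + 1, by omega⟩, u.2) else none)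
    else if s = j then
      (if h : (u.2 : ℕ) < q then some (u.1, ⟨(u.2 : ℕ) + 1, by omega⟩) else none)
    else none

/-- `B_n`-crystal: components with colors `n-1, n` are worm graphs,
with color `n-1` corresponding to `1tilde` and `n` to `2tilde`. -/
def IsBCrystal (n : ℕ) (B : PreGraph) : Prop :=
  IsColored B (Set.Icc 1 n) ∧ B.Connected ∧
  (∀ i ∈ Set.Icc 1 n, ∀ j ∈ Set.Icc 1 n, Far i j → A5at B i j) ∧
  (∀ i j, 1 ≤ i → i < n → 1 ≤ j → j < n → Neighb i j →
    ∀ v : B.V, IsCrystalOn (B.sub {i, j} v) {i, j}) ∧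
  (∀ v : B.V, ∃ g1 g2 : ℕ,
    IsoVia (B.sub ({n - 1, n} : Set ℕ) v) (WormGraph g1 g2)
      (fun x => if x = n - 1 then 1 else if x = n then 2 else 0))

/-- `C_n`-crystal: components with colors `n-1, n` are worm graphs,
with color `n-1` corresponding to `2tilde` and `n` to `1tilde`. -/
def IsCCrystal (n : ℕ) (B : PreGraph) : Prop :=
  IsColored B (Set.Icc 1 n) ∧ B.Connected ∧
  (∀ i ∈ Set.Icc 1 n, ∀ j ∈ Set.Icc 1 n, Far i j → A5at B i j) ∧
  (∀ i j, 1 ≤ i → i < n → 1 ≤ j → j < n → Neighb i j →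
    ∀ v : B.V, IsCrystalOn (B.sub {i, j} v) {i, j}) ∧
  (∀ v : B.V, ∃ g1 g2 : ℕ,
    IsoVia (B.sub ({n - 1, n} : Set ℕ) v) (WormGraph g1 g2)
      (fun x => if x = n - 1 then 2 else if x = n then 1 else 0))

/-! ### The crossing model -/

/-- `(k, i, j)` is a node `v_i^k(j)` of the supporting graph `G` for rank `n`. -/
def isNode (n k i j : ℕ) : Prop :=
  1 ≤ j ∧ j ≤ i ∧ i ≤ n ∧ i - j + 1 ≤ k ∧ k ≤ n - j + 1

instance (n k i j : ℕ) : Decidable (isNode n k i j) := by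
  unfold isNode; infer_instance

/-- Extension of a function on the nodes of `G` to the extended supporting graph:
extra nodes from which `G^k` is reachable get value `c k`, the others get `0`. -/
def fext (n : ℕ) (c : ℕ → ℕ) (f : ℕ × ℕ × ℕ → ℤ) (k i j : ℕ) : ℤ :=
  if isNode n k i j then f (k, i, j)
  else if j ≤ n - k + 1 then (c k : ℤ) else 0

/-- The slack at the node `v_i^k(j)`. -/
def epsN (n : ℕ) (c : ℕ → ℕ) (f : ℕ × ℕ × ℕ → ℤ) (k i j : ℕ) : ℤ :=
  (fext n c f k (i - 1) (j - 1) - fext n c f k i j) -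
    (fext n c f k i (j - 1) - fext n c f k (i + 1) j)

/-- The total slack at the multinode `V_i(j)`. -/
def epsTot (n : ℕ) (c : ℕ → ℕ) (f : ℕ × ℕ × ℕ → ℤ) (i j : ℕ) : ℤ :=
  ∑ k ∈ Finset.Icc (i - j + 1) (n - j + 1), epsN n c f k i j

/-- The reduced slack at the multinode `V_i(j)`. -/
def teps (n : ℕ) (c : ℕ → ℕ) (f : ℕ × ℕ × ℕ → ℤ) (i j : ℕ) : ℤ :=
  if hj : (Finset.Icc 1 j).Nonempty then
    max 0 ((Finset.Icc 1 j).inf' hj fun p => ∑ q ∈ Finset.Icc p j, epsTot n c f i q)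
  else 0

/-- `k0` satisfies the switch condition in the multinode `V_i(j)`. -/
def switchCond (n : ℕ) (f : ℕ × ℕ × ℕ → ℤ) (i j k0 : ℕ) : Prop :=
  i - j + 1 ≤ k0 ∧ k0 ≤ n - j + 1 ∧
  (∀ k, i - j + 1 ≤ k → k < k0 → isNode n k (i + 1) (j + 1) →
    f (k, i, j) = f (k, i + 1, j + 1)) ∧
  (∀ k, k0 < k → k ≤ n - j + 1 → isNode n k (i + 1) j →
    f (k, i + 1, j) = f (k, i, j))

/-- The switch-node (first node with the switch property) of the multinode `V_i(j)`. -/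
def switchNode (n : ℕ) (f : ℕ × ℕ × ℕ → ℤ) (i j : ℕ) : ℕ :=
  sInf {k0 | switchCond n f i j k0}

/-- Feasible functions of the crossing model (normalized to vanish off the nodes). -/
def Feasible (n : ℕ) (c : ℕ → ℕ) (f : ℕ × ℕ × ℕ → ℤ) : Prop :=
  (∀ k i j, ¬ isNode n k i j → f (k, i, j) = 0) ∧
  (∀ k i j, isNode n k i j → isNode n k (i - 1) j → f (k, i - 1, j) ≤ f (k, i, j)) ∧
  (∀ k i j, isNode n k i j → isNode n k (i + 1) (j + 1) → f (k, i + 1, j + 1) ≤ f (k, i, j)) ∧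
  (∀ k i j, isNode n k i j → 0 ≤ f (k, i, j) ∧ f (k, i, j) ≤ (c k : ℤ)) ∧
  (∀ i j, 1 ≤ j → j ≤ i → i ≤ n → ∃ k0, switchCond n f i j k0)

/-- Increase `f` by one at the node `(k, i, j)`. -/
def bump (f : ℕ × ℕ × ℕ → ℤ) (k i j : ℕ) : ℕ × ℕ × ℕ → ℤ :=
  fun x => if x = (k, i, j) then f x + 1 else f x

/-- The crossing-model graph `Kscr(c)`: vertices are the feasible functions, and
the move `φ_i` increases `f` by one at the switch-node of the active multinode. -/
def Kscr (n : ℕ) (c : ℕ → ℕ) : PreGraph where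
  V := {f : ℕ × ℕ × ℕ → ℤ // Feasible n c f}
  F := fun i f =>
    if 1 ≤ i ∧ i ≤ n ∧ ∃ j, 1 ≤ j ∧ j ≤ i ∧ 0 < teps n c f.1 i j then
      (let j := sSup {j | 1 ≤ j ∧ j ≤ i ∧ 0 < teps n c f.1 i j}
       let g := bump f.1 (switchNode n f.1 i j) i j
       if hg : Feasible n c g then some ⟨g, hg⟩ else none)
    else none

/-- The function `f_{a,D}` of the crossing model. -/
def faD (n : ℕ) (a : ℕ → ℕ) (D : ℕ → ℤ) : ℕ × ℕ × ℕ → ℤ := fun x =>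
  if isNode n x.1 x.2.1 x.2.2 then
    (if x.2.1 - x.2.2 + 1 = x.1 then (a x.1 : ℤ) else (a x.1 : ℤ) + min (D (x.1 - 1)) 0) +
    (if x.2.2 ≤ n - x.1 then max (D x.1) 0 else 0)
  else 0

/-! ### Descriptions of self-complementary vertices -/

/-- `(a1, a2, δ, l)` is the description of a self-complementary vertex `v` of a
symmetric `A_3`-crystal `K` with source `s` and parameter `c`. -/
def IsDescB (K : PreGraph) (s : K.V) (c : ℕ → ℕ) (v : K.V) (q : ℕ × ℕ × ℤ × ℕ) : Prop :=
  q.2.2.2 = K.t 2 v ∧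
  ∃ (a : ℕ → ℕ) (pa : K.V),
    a 1 = q.1 ∧ a 2 = q.2.1 ∧ a 3 = ((q.1 : ℤ) + max q.2.2.1 0).toNat ∧
    (∀ i, 1 ≤ i → i ≤ 3 → a i ≤ c i) ∧
    IsPrin K 0 3 s a pa ∧ inComp K (Set.Icc 1 2) pa v ∧
    0 ≤ (q.2.1 : ℤ) + q.2.2.1 ∧ 0 ≤ (a 3 : ℤ) - q.2.2.1 ∧
    ∃ s' : (K.sub (Set.Icc 1 2) pa).V, IsSource (K.sub (Set.Icc 1 2) pa) s' ∧
    ∃ z : (K.sub (Set.Icc 1 2) pa).V,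
      IsPrin (K.sub (Set.Icc 1 2) pa) 0 2 s'
        (fun i => if i = 1 then ((q.2.1 : ℤ) + q.2.2.1).toNat else ((a 3 : ℤ) - q.2.2.1).toNat) z ∧
      inComp K ({2} : Set ℕ) z.1 v

/-- The polytope of descriptions for a symmetric `A_3`-crystal with parameter `(c1, c2, c1)`. -/
def QuadB (c1 c2 : ℕ) : Set (ℕ × ℕ × ℤ × ℕ) :=
  {q | q.1 ≤ c1 ∧ q.2.1 ≤ c2 ∧ -(q.2.1 : ℤ) ≤ q.2.2.1 ∧ (q.2.1 : ℤ) - (c2 : ℤ) ≤ q.2.2.1 ∧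
       q.2.2.1 ≤ (c1 : ℤ) - (q.1 : ℤ) ∧ (q.2.2.2 : ℤ) ≤ (c2 : ℤ) + 2 * q.2.2.1}

/-- The worm associated to the description `(a1, a2, δ, l)`. -/
def wtupleB (a1 a2 : ℕ) (δ : ℤ) (l : ℕ) : ℤ × ℤ × ℤ × ℤ × ℤ × ℤ :=
  let a3 : ℤ := (a1 : ℤ) + max δ 0
  let tr : ℤ × ℤ × ℤ :=
    if 0 ≤ δ then
      if (l : ℤ) ≤ (a2 : ℤ) then ((l : ℤ), 2 * (a1 : ℤ), (a2 : ℤ))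
      else if (l : ℤ) ≤ (a2 : ℤ) + 2 * δ then
        ((a2 : ℤ), 2 * (a1 : ℤ) + (l : ℤ) - (a2 : ℤ), (a2 : ℤ))
      else ((a2 : ℤ), 2 * a3, (l : ℤ) - 2 * δ)
    else
      if (l : ℤ) ≤ (a2 : ℤ) + δ then ((l : ℤ), 2 * (a1 : ℤ), (a2 : ℤ) - δ)
      else ((a2 : ℤ) + δ, 2 * (a1 : ℤ), (l : ℤ) - 2 * δ)
  (2 * (a1 : ℤ), (a2 : ℤ), 2 * a3, tr.1, tr.2.1, tr.2.2)

def wtQ (q : ℕ × ℕ × ℤ × ℕ) : ℤ × ℤ × ℤ × ℤ × ℤ × ℤ :=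
  wtupleB q.1 q.2.1 q.2.2.1 q.2.2.2

/-- The string `(F_2 F_3)^r (F_3 F_2)^r` (rightmost applied first). -/
def diagStr (r : ℕ) : List ℕ :=
  (List.replicate r ([2, 3] : List ℕ)).flatten ++ (List.replicate r ([3, 2] : List ℕ)).flatten

/-- `(a1, a2, δ, ρ)` is the description of a self-complementary vertex `v` of a
symmetric `A_4`-crystal `K` with source `s` and parameter `c`. -/
def IsDescC (K : PreGraph) (s : K.V) (c : ℕ → ℕ) (v : K.V) (q : ℕ × ℕ × ℤ × ℕ) : Prop :=
  ∃ (a : ℕ → ℕ) (pa : K.V),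
    a 1 = q.1 ∧ a 2 = q.2.1 ∧ a 3 = ((q.2.1 : ℤ) + min q.2.2.1 0).toNat ∧
    a 4 = ((q.1 : ℤ) + max q.2.2.1 0).toNat ∧
    (∀ i, 1 ≤ i → i ≤ 4 → a i ≤ c i) ∧
    IsPrin K 0 4 s a pa ∧ inComp K (Set.Icc 1 3) pa v ∧
    0 ≤ (q.2.1 : ℤ) + q.2.2.1 ∧ 0 ≤ (a 4 : ℤ) - q.2.2.1 ∧
    (∃ s' : (K.sub (Set.Icc 1 3) pa).V, IsSource (K.sub (Set.Icc 1 3) pa) s' ∧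
     ∃ z : (K.sub (Set.Icc 1 3) pa).V,
       IsPrin (K.sub (Set.Icc 1 3) pa) 0 3 s'
         (fun i => if i = 1 then ((q.2.1 : ℤ) + q.2.2.1).toNat
                   else if i = 2 then a 3 else ((a 4 : ℤ) - q.2.2.1).toNat) z ∧
       inComp K (Set.Icc 2 3) z.1 v) ∧
    (∃ stil : (K.sub (Set.Icc 2 3) v).V, IsSource (K.sub (Set.Icc 2 3) v) stil ∧
       applyStr (K.sub (Set.Icc 2 3) v) (diagStr q.2.2.2) stil =
         some ⟨v, Relation.ReflTransGen.refl⟩)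

/-- The polytope of descriptions for a symmetric `A_4`-crystal with parameter
`(c1, c2, c2, c1)`. -/
def QuadC (c1 c2 : ℕ) : Set (ℕ × ℕ × ℤ × ℕ) :=
  {q | q.1 ≤ c1 ∧ q.2.1 ≤ c2 ∧ -(q.2.1 : ℤ) ≤ q.2.2.1 ∧
       q.2.2.1 ≤ (c1 : ℤ) - (q.1 : ℤ) ∧ (q.2.2.2 : ℤ) ≤ (c2 : ℤ) + q.2.2.1}

end

/-! ### Local theory of operators of one, two and three colors -/

/-- The operators of one color, made total: `f` follows an edge, `e` goes back along an edge,
and `h`, `t` are the lengths of the remaining parts of the line. -/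
structure ColorOps (V : Type) where
  f : V → V
  e : V → V
  h : V → ℤ
  t : V → ℤ

namespace ColorOps

variable {V : Type} {A B C : ColorOps V}

/-- The operators obtained by reversing all edges. -/
def dual (A : ColorOps V) : ColorOps V := ⟨A.e, A.f, A.t, A.h⟩

/-- The edges of one color form a disjoint union of finite paths. -/
structure IsLine (A : ColorOps V) : Prop where
  h_nonneg : ∀ v, 0 ≤ A.h v
  t_nonneg : ∀ v, 0 ≤ A.t v
  ef : ∀ v, 0 < A.h v → A.e (A.f v) = v
  fe : ∀ v, 0 < A.t v → A.f (A.e v) = v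
  h_f : ∀ v, 0 < A.h v → A.h (A.f v) = A.h v - 1
  t_f : ∀ v, 0 < A.h v → A.t (A.f v) = A.t v + 1
  h_e : ∀ v, 0 < A.t v → A.h (A.e v) = A.h v + 1
  t_e : ∀ v, 0 < A.t v → A.t (A.e v) = A.t v - 1

lemma IsLine.dual (H : A.IsLine) : A.dual.IsLine :=
  ⟨H.t_nonneg, H.h_nonneg, H.fe, H.ef, H.t_e, H.h_e, H.t_f, H.h_f⟩

/-- The effect of the edges of color `A` on the lines of a neighboring color `B`:
labels, their monotonicity, and the commutation relations. -/
structure Acts (A B : ColorOps V) : Prop where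
  lab_f : ∀ v, 0 < A.h v →
    (B.h (A.f v) = B.h v ∧ B.t (A.f v) = B.t v - 1) ∨
      (B.t (A.f v) = B.t v ∧ B.h (A.f v) = B.h v + 1)
  lab_e : ∀ v, 0 < A.t v →
    (B.t (A.e v) = B.t v ∧ B.h (A.e v) = B.h v - 1) ∨
      (B.h (A.e v) = B.h v ∧ B.t (A.e v) = B.t v + 1)
  conv_f : ∀ v, 0 < A.h v → 0 < A.h (A.f v) → B.t (A.f v) = B.t v →
    B.t (A.f (A.f v)) = B.t (A.f v)
  conv_e : ∀ v, 0 < A.t v → 0 < A.t (A.e v) → B.h (A.e v) = B.h v →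
    B.h (A.e (A.e v)) = B.h (A.e v)
  sq_f : ∀ v, 0 < A.h v → 0 < B.h v → B.h (A.f v) = B.h v →
    A.h (B.f v) = A.h v + 1 ∧ B.f (A.f v) = A.f (B.f v)
  sq_e : ∀ v, 0 < A.t v → 0 < B.t v → B.t (A.e v) = B.t v →
    A.t (B.e v) = A.t v + 1 ∧ B.e (A.e v) = A.e (B.e v)

lemma Acts.dual (H : Acts A B) : Acts A.dual B.dual :=
  ⟨H.lab_e, H.lab_f, H.conv_e, H.conv_f, H.sq_e, H.sq_f⟩

/-- Two neighboring colors. -/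
structure Pair (A B : ColorOps V) : Prop where
  lineA : A.IsLine
  lineB : B.IsLine
  AB : Acts A B
  BA : Acts B A

lemma Pair.swap (P : Pair A B) : Pair B A := ⟨P.lineB, P.lineA, P.BA, P.AB⟩

lemma Pair.dual (P : Pair A B) : Pair A.dual B.dual :=
  ⟨P.lineA.dual, P.lineB.dual, P.AB.dual, P.BA.dual⟩

/-- A critical vertex: all incoming edges are labeled `0` and all outgoing edges `1`. -/
structure Crit (A B : ColorOps V) (x : V) : Prop where
  inA : 0 < A.t x → B.h (A.e x) = B.h x
  inB : 0 < B.t x → A.h (B.e x) = A.h x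
  outA : 0 < A.h x → B.t (A.f x) = B.t x
  outB : 0 < B.h x → A.t (B.f x) = A.t x

lemma Crit.swap {x : V} (H : Crit A B x) : Crit B A x := ⟨H.inB, H.inA, H.outB, H.outA⟩

lemma Crit.dual {x : V} (H : Crit A B x) : Crit A.dual B.dual x :=
  ⟨H.outA, H.outB, H.inA, H.inB⟩

lemma Crit.of_dual {x : V} (H : Crit A.dual B.dual x) : Crit A B x :=
  ⟨H.outA, H.outB, H.inA, H.inB⟩

lemma Pair.outB_of_inA (P : Pair A B) {x : V} (hin : 0 < A.t x → B.h (A.e x) = B.h x)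
    (hb : 0 < B.h x) : A.t (B.f x) = A.t x := by
  have hl := P.BA.lab_f x hb
  by_cases ht : 0 < A.t x
  · have h1 := hin ht
    have h2 := P.lineA.h_e x ht
    have h3 := P.lineA.h_nonneg x
    have h4 := P.lineA.fe x ht
    have h5 := P.lineA.t_e x ht
    obtain ⟨h6, h7⟩ := P.AB.sq_f (A.e x) (by omega) (by omega) (by rw [h4, h1])
    rw [h4] at h7
    have h8 := P.BA.lab_f (A.e x) (by omega)
    have h9 := P.lineA.t_f (B.f (A.e x)) (by omega)
    rw [h7]
    omega
  · have := P.lineA.t_nonneg x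
    have := P.lineA.t_nonneg (B.f x)
    omega

lemma Pair.outA_of_inB (P : Pair A B) {x : V} (hin : 0 < B.t x → A.h (B.e x) = A.h x)
    (ha : 0 < A.h x) : B.t (A.f x) = B.t x :=
  P.swap.outB_of_inA hin ha

lemma Pair.inB_of_outA (P : Pair A B) {x : V} (hout : 0 < A.h x → B.t (A.f x) = B.t x)
    (hb : 0 < B.t x) : A.h (B.e x) = A.h x :=
  P.dual.outB_of_inA hout hb

lemma Pair.inA_of_outB (P : Pair A B) {x : V} (hout : 0 < B.h x → A.t (B.f x) = A.t x)
    (ha : 0 < A.t x) : B.h (A.e x) = B.h x :=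
  P.swap.inB_of_outA hout ha

lemma Pair.crit_of_in (P : Pair A B) {x : V} (h1 : 0 < A.t x → B.h (A.e x) = B.h x)
    (h2 : 0 < B.t x → A.h (B.e x) = A.h x) : Crit A B x :=
  ⟨h1, h2, P.outA_of_inB h2, P.outB_of_inA h1⟩

lemma Pair.crit_of_lineA (P : Pair A B) {x : V} (h1 : 0 < A.t x → B.h (A.e x) = B.h x)
    (h2 : 0 < A.h x → B.t (A.f x) = B.t x) : Crit A B x :=
  P.crit_of_in h1 (P.inB_of_outA h2)

lemma Pair.crit_of_lineB (P : Pair A B) {x : V} (h1 : 0 < B.t x → A.h (B.e x) = A.h x)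
    (h2 : 0 < B.h x → A.t (B.f x) = A.t x) : Crit A B x :=
  P.crit_of_in (P.inA_of_outB h2) h1

/-- The operator string `e_B e_A` preserves critical vertices. -/
lemma Pair.crit_e (P : Pair A B) {x : V} (H : Crit A B x) (ht : 0 < A.t x) :
    0 < B.t (A.e x) ∧ Crit A B (B.e (A.e x)) ∧
      A.t (B.e (A.e x)) = A.t x - 1 ∧ B.t (B.e (A.e x)) = B.t x ∧
      A.h (B.e (A.e x)) = A.h x ∧ B.h (B.e (A.e x)) = B.h x + 1 := by
  have h1 := H.inA ht
  have h2 := P.AB.lab_e x ht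
  have h3 := P.lineB.t_nonneg x
  have hty : 0 < B.t (A.e x) := by omega
  have h4 := P.lineA.fe x ht
  have h5 := P.lineA.h_e x ht
  have h6 := P.lineA.t_e x ht
  have h7 := P.lineA.h_nonneg x
  set y := A.e x with hy
  have h8 := P.lineB.fe y hty
  have h9 := P.lineB.h_e y hty
  have h10 := P.lineB.t_e y hty
  have h11 := P.BA.lab_e y hty
  have h12 := P.lineB.h_nonneg x
  set z := B.e y with hz
  have hlab : A.t z = A.t y ∧ A.h z = A.h y - 1 := by
    rcases h11 with h | ⟨h, -⟩
    · exact h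
    · exfalso
      obtain ⟨h13, h14⟩ := P.BA.sq_f z (by omega) (by omega) (by rw [h8, h])
      rw [h8, h4] at h14
      have h15 := P.AB.lab_f z (by omega)
      have h16 := P.lineB.h_f (A.f z) (by omega)
      rw [← h14] at h16
      omega
  have houtB : 0 < B.h z → A.t (B.f z) = A.t z := fun _ => by rw [h8, hlab.1]
  have houtA : 0 < A.h z → B.t (A.f z) = B.t z := by
    intro hz1
    rcases P.AB.lab_f z hz1 with ⟨h, h'⟩ | ⟨h, -⟩
    · exfalso
      obtain ⟨h13, h14⟩ := P.AB.sq_f z hz1 (by omega) h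
      rw [h8, h4] at h14
      have h15 := P.lineB.ef (A.f z) (by omega)
      have h16 := P.lineB.t_f (A.f z) (by omega)
      have h18 := P.lineB.t_nonneg (A.f z)
      rw [h14] at h15 h16
      have h17 := H.inB (by omega)
      rw [h15] at h17
      have := P.lineA.h_f z hz1
      omega
    · exact h
  refine ⟨hty, P.crit_of_in (P.inA_of_outB houtB) (P.inB_of_outA houtA), ?_⟩
  omega

/-- The operator string `f_B f_A` preserves critical vertices. -/
lemma Pair.crit_f (P : Pair A B) {x : V} (H : Crit A B x) (hh : 0 < A.h x) :
    0 < B.h (A.f x) ∧ Crit A B (B.f (A.f x)) ∧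
      A.h (B.f (A.f x)) = A.h x - 1 ∧ B.h (B.f (A.f x)) = B.h x ∧
      A.t (B.f (A.f x)) = A.t x ∧ B.t (B.f (A.f x)) = B.t x + 1 := by
  obtain ⟨h1, h2, h3⟩ := P.dual.crit_e H.dual hh
  exact ⟨h1, h2.of_dual, h3⟩

/-- Two distant colors. -/
structure Distant (A C : ColorOps V) : Prop where
  h_f : ∀ v, 0 < C.h v → A.h (C.f v) = A.h v
  t_f : ∀ v, 0 < C.h v → A.t (C.f v) = A.t v
  h_e : ∀ v, 0 < C.t v → A.h (C.e v) = A.h v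
  t_e : ∀ v, 0 < C.t v → A.t (C.e v) = A.t v
  ff : ∀ v, 0 < A.h v → 0 < C.h v → A.f (C.f v) = C.f (A.f v)
  fe : ∀ v, 0 < A.h v → 0 < C.t v → A.f (C.e v) = C.e (A.f v)
  ef : ∀ v, 0 < A.t v → 0 < C.h v → A.e (C.f v) = C.f (A.e v)
  ee : ∀ v, 0 < A.t v → 0 < C.t v → A.e (C.e v) = C.e (A.e v)

/-- The Verma relation of degree four. -/
def Verma (A B : ColorOps V) : Prop :=
  ∀ v, 0 < A.h v → 0 < B.h v → B.t (A.f v) = B.t v → A.t (B.f v) = A.t v →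
    A.f (B.f (B.f (A.f v))) = B.f (A.f (A.f (B.f v))) ∧
      0 < A.h (B.f (B.f (A.f v))) ∧ 0 < B.h (A.f (A.f (B.f v)))

/-- Three consecutive colors `A`, `B`, `C`. -/
structure Triple (A B C : ColorOps V) : Prop where
  AB : Pair A B
  CB : Pair C B
  AC : Distant A C
  CA : Distant C A
  vermaA : Verma A B
  vermaC : Verma C B

lemma Triple.swap (T : Triple A B C) : Triple C B A :=
  ⟨T.CB, T.AB, T.CA, T.AC, T.vermaC, T.vermaA⟩

/-- A vertex critical for both pairs of neighboring colors, whose neighbors along the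
`A`-line are critical for the pair `C`, `B`. -/
structure BiCrit (A B C : ColorOps V) (x : V) : Prop where
  critA : Crit A B x
  critC : Crit C B x
  crit_e : 0 < A.t x → Crit C B (A.e x)
  crit_f : 0 < A.h x → Crit C B (A.f x)

lemma BiCrit.crit_fC (T : Triple A B C) {x : V} (H : BiCrit A B C x) (hh : 0 < C.h x) :
    Crit A B (C.f x) := by
  have a1 := T.AC.t_f x hh
  have a2 := T.AC.h_f x hh
  have a3 := H.critC.outA hh
  have a4 := T.CB.AB.lab_f x hh
  refine T.AB.crit_of_lineA (fun h => ?_) (fun h => ?_)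
  · have h0 : 0 < A.t x := by omega
    rw [T.AC.ef x h0 hh]
    have h1 : 0 < C.h (A.e x) := by rw [T.CA.h_e x h0]; exact hh
    have h2 := (H.crit_e h0).outA h1
    have h3 := T.CB.AB.lab_f (A.e x) h1
    have h4 := H.critA.inA h0
    omega
  · have h0 : 0 < A.h x := by omega
    rw [T.AC.ff x h0 hh]
    have h1 : 0 < C.h (A.f x) := by rw [T.CA.h_f x h0]; exact hh
    have h2 := (H.crit_f h0).outA h1
    have h4 := H.critA.outA h0
    omega

lemma BiCrit.crit_eC (T : Triple A B C) {x : V} (H : BiCrit A B C x) (hh : 0 < C.t x) :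
    Crit A B (C.e x) := by
  have a1 := T.AC.t_e x hh
  have a2 := T.AC.h_e x hh
  have a3 := H.critC.inA hh
  have a4 := T.CB.AB.lab_e x hh
  refine T.AB.crit_of_lineA (fun h => ?_) (fun h => ?_)
  · have h0 : 0 < A.t x := by omega
    rw [T.AC.ee x h0 hh]
    have h1 : 0 < C.t (A.e x) := by rw [T.CA.t_e x h0]; exact hh
    have h2 := (H.crit_e h0).inA h1
    have h4 := H.critA.inA h0
    omega
  · have h0 : 0 < A.h x := by omega
    rw [T.AC.fe x h0 hh]
    have h1 : 0 < C.t (A.f x) := by rw [T.CA.t_f x h0]; exact hh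
    have h2 := (H.crit_f h0).inA h1
    have h3 := T.CB.AB.lab_e (A.f x) h1
    have h4 := H.critA.outA h0
    omega

lemma BiCrit.swap (T : Triple A B C) {x : V} (H : BiCrit A B C x) : BiCrit C B A x :=
  ⟨H.critC, H.critA, H.crit_eC T, H.crit_fC T⟩

lemma BiCrit.crit_ff (T : Triple A B C) {x : V} (H : BiCrit A B C x) (h1 : 0 < A.h x)
    (h2 : 0 < A.h (A.f x)) : Crit C B (A.f (A.f x)) := by
  have b1 := H.critA.outA h1
  have b2 := T.AB.AB.conv_f x h1 h2 b1
  refine T.CB.crit_of_lineA (fun h => ?_) (fun h => ?_)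
  · have c1 : 0 < C.t (A.f x) := by rwa [T.CA.t_f _ h2] at h
    have c2 : 0 < C.t x := by rwa [T.CA.t_f _ h1] at c1
    have c3 := (H.swap T).crit_e c2
    rw [T.CA.ef _ c1 h2, T.CA.ef _ c2 h1]
    have c4 : 0 < A.h (C.e x) := by rw [T.AC.h_e _ c2]; exact h1
    have c5 : 0 < A.h (A.f (C.e x)) := by
      rw [← T.CA.ef _ c2 h1, T.AC.h_e _ c1]; exact h2
    have c6 := c3.outA c4
    have c7 := T.AB.AB.conv_f _ c4 c5 c6
    have c8 := T.AB.AB.lab_f _ c4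
    have c9 := T.AB.AB.lab_f _ c5
    have c10 := T.AB.AB.lab_f _ h1
    have c11 := T.AB.AB.lab_f _ h2
    have c12 := H.critC.inA c2
    omega
  · have c1 : 0 < C.h (A.f x) := by rwa [T.CA.h_f _ h2] at h
    have c2 : 0 < C.h x := by rwa [T.CA.h_f _ h1] at c1
    have c3 := (H.swap T).crit_f c2
    rw [T.CA.ff _ c1 h2, T.CA.ff _ c2 h1]
    have c4 : 0 < A.h (C.f x) := by rw [T.AC.h_f _ c2]; exact h1
    have c5 : 0 < A.h (A.f (C.f x)) := by
      rw [← T.CA.ff _ c2 h1, T.AC.h_f _ c1]; exact h2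
    have c6 := c3.outA c4
    have c7 := T.AB.AB.conv_f _ c4 c5 c6
    have c12 := H.critC.outA c2
    omega

/-- The string `f_C f_B f_A` preserves bicritical vertices. -/
lemma BiCrit.string_CBA (T : Triple A B C) {x : V} (H : BiCrit A B C x) (hh : 0 < A.h x) :
    BiCrit A B C (C.f (B.f (A.f x))) ∧
      A.h (C.f (B.f (A.f x))) = A.h x - 1 ∧ B.h (C.f (B.f (A.f x))) = B.h x ∧
      C.h (C.f (B.f (A.f x))) = C.h x ∧ A.t (C.f (B.f (A.f x))) = A.t x ∧
      B.t (C.f (B.f (A.f x))) = B.t x ∧ C.t (C.f (B.f (A.f x))) = C.t x + 1 := by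
  have hy := H.crit_f hh
  have y1 := H.critA.outA hh
  have y2 := T.AB.AB.lab_f x hh
  have y3 := T.AB.lineA.h_f x hh
  have y4 := T.CA.h_f x hh
  have y5 := T.CA.t_f x hh
  obtain ⟨hyB, hz, z1, z2, z3, z4⟩ := T.AB.crit_f H.critA hh
  obtain ⟨hzC, hw, w1, w2, w3, w4⟩ := T.CB.swap.crit_f hy.swap hyB
  have z5 := hy.outB hyB
  set y := A.f x with y_def
  set z := B.f y with z_def
  have w5 := T.AC.h_f z hzC
  have w6 := T.AC.t_f z hzC
  set w := C.f z with w_def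
  have z_lab := T.CB.AB.lab_f z hzC
  have z_t := T.AB.lineA.t_nonneg z
  have hwA : Crit A B w := by
    refine T.AB.crit_of_lineA (fun h => ?_) (fun h => ?_)
    · have h0 : 0 < A.t z := by omega
      have h1 : 0 < C.h (A.e z) := by rw [T.CA.h_e z h0]; exact hzC
      have h2 := hz.inA h0
      have h3 := T.CB.AB.lab_f (A.e z) h1
      have h4 := T.AB.AB.lab_e w h
      have h5 := T.AC.ef z h0 hzC
      rw [← w_def] at h5
      rw [← h5] at h3
      omega
    · have h0 : 0 < A.h z := by omega
      have h1 : 0 < C.h (A.f z) := by rw [T.CA.h_f z h0]; exact hzC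
      have h2 := hz.outA h0
      have h3 := T.CB.AB.lab_f (A.f z) h1
      have h4 := T.AB.AB.lab_f w h
      have h5 := T.AC.ff z h0 hzC
      rw [← w_def] at h5
      rw [← h5] at h3
      omega
  have hwf : 0 < A.h w → Crit C B (A.f w) := by
    intro h
    have h0 : 0 < A.h z := by omega
    have h1 : 0 < A.h y := by omega
    obtain ⟨-, h2⟩ := T.AB.BA.sq_f y hyB h1 (by rw [← z_def]; omega)
    have h3 : Crit C B (A.f y) := H.crit_ff T hh h1
    have h4 := T.AB.AB.lab_f y h1
    have h5 := (T.CB.swap.crit_f h3.swap (by omega)).2.1.swap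
    rw [w_def, T.AC.ff z h0 hzC, z_def, h2]
    exact h5
  have hwe : 0 < A.t w → Crit C B (A.e w) := by
    intro h
    have h0 : 0 < A.t z := by omega
    have hx : 0 < A.t x := by omega
    obtain ⟨gB, hd, d1, d2, d3, d4⟩ := T.AB.crit_e H.critA hx
    have hg := H.crit_e hx
    have g1 := T.CA.t_e x hx
    have d5 := hg.inB gB
    have d6 := T.CB.BA.lab_e _ gB
    have d7 := T.AB.lineB.fe _ gB
    have d8 := T.AB.lineA.fe x hx
    set g := A.e x with g_def
    set d := B.e g with d_def
    have Bx := T.AB.lineB.h_nonneg x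
    obtain ⟨v1, v2, -⟩ := T.vermaA d (by omega) (by omega) (hd.outA (by omega))
      (hd.outB (by omega))
    rw [d7, d8, ← y_def, ← z_def] at v1
    have e1 : A.e z = B.f (B.f (A.f d)) := by rw [← v1, T.AB.lineA.ef _ v2]
    have q1 := T.CA.t_f d (by omega)
    have q2 := T.AB.AB.lab_f d (by omega)
    have q3 := hd.outA (by omega)
    set p := A.f d with p_def
    have q4 : 0 < B.h p := by omega
    have q5 := T.AB.lineB.h_f p q4
    have q6 := T.CB.BA.lab_f p q4
    have q7 := T.CB.BA.lab_f (B.f p) (by omega)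
    have q8 := T.CB.BA.conv_f p q4 (by omega)
    have q9 := T.CA.t_e z h0
    rw [e1] at q9
    have key : Crit C B (B.f p) := by
      refine T.CB.crit_of_lineB (fun _ => ?_) (fun _ => ?_)
      · rw [T.AB.lineB.ef p q4]
        omega
      · omega
    have h5 := (T.CB.swap.crit_f key.swap (by omega)).2.1.swap
    rw [w_def, T.AC.ef z h0 hzC, e1]
    exact h5
  refine ⟨⟨hwA, hw.swap, hwe, hwf⟩, ?_⟩
  omega

/-- The condition on the `B`-predecessor that makes the string `f_B f_C f_A f_B` preserve
bicritical vertices. -/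
structure PreCrit (A B C : ColorOps V) (x : V) : Prop where
  eA : 0 < B.t x → Crit C B (A.e (B.e x))
  eC : 0 < B.t x → Crit A B (C.e (B.e x))

lemma PreCrit.swap {x : V} (H : PreCrit A B C x) : PreCrit C B A x := ⟨H.eC, H.eA⟩

/-- If `x` is bicritical, then `f_A f_B x` is critical for both pairs of colors. -/
lemma BiCrit.crit_AB (T : Triple A B C) {x : V} (H : BiCrit A B C x) (N : PreCrit A B C x)
    (hh : 0 < B.h x) :
    Crit C B (A.f (B.f x)) ∧
      (0 < A.h (A.f (B.f x)) → Crit C B (A.f (A.f (B.f x)))) := by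
  obtain ⟨hyA, hp, p1, p2, p3, p4⟩ := T.AB.swap.crit_f H.critA.swap hh
  have y1 := H.critC.outB hh
  have y2 := T.CB.BA.lab_f x hh
  set y := B.f x with y_def
  have p5 := T.CA.h_f y hyA
  have p6 := T.CA.t_f y hyA
  set p := A.f y with p_def
  -- the predecessor of `p` along its `C`-line is `f_A f_B` of the predecessor of `x`
  have hCe : 0 < C.t p → Crit A B (C.e p) ∧ B.h (C.e p) = B.h p := by
    intro h
    have h0 : 0 < C.t x := by omega
    have h1 : 0 < C.t y := by omega
    have h2 := (H.swap T).crit_e h0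
    have h3 := H.critC.inA h0
    have h4 := T.CB.lineA.h_e x h0
    have h5 := T.CB.lineA.h_nonneg x
    have h6 := T.CB.lineA.fe x h0
    obtain ⟨h7, h8⟩ := T.CB.AB.sq_f (C.e x) (by omega) (by omega) (by rw [h6, h3])
    rw [h6, ← y_def] at h8
    have h9 : C.e y = B.f (C.e x) := by rw [h8, T.CB.lineA.ef _ (by omega)]
    obtain ⟨-, k1, k2, k3, -⟩ := T.AB.swap.crit_f h2.swap (by omega)
    have h10 : C.e p = A.f (B.f (C.e x)) := by rw [p_def, T.CA.ef y h1 hyA, h9]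
    rw [h10]
    refine ⟨k1.swap, ?_⟩
    omega
  have hBe : 0 < B.t p → C.h (B.e p) = C.h p := by
    intro h
    have h0 : 0 < B.t x := by omega
    obtain ⟨uA, hn, n1, n2, n3, n4⟩ := T.AB.swap.crit_e H.critA.swap h0
    have u1 := H.critC.inB h0
    have n5 := T.CA.h_e _ uA
    have n6 := T.AB.lineA.fe _ uA
    have n7 := N.eA h0
    have n8 := T.AB.lineB.fe x h0
    set n := A.e (B.e x) with n_def
    have Ax := T.AB.lineA.h_nonneg x
    have n9 := n7.outB (by omega)
    have n10 := T.CB.BA.lab_f n (by omega)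
    obtain ⟨v1, -, v3⟩ := T.vermaA n (by omega) (by omega) (hn.outB (by omega))
      (hn.outA (by omega))
    rw [n6, n8, ← y_def, ← p_def] at v1
    have m1 := T.AB.BA.lab_f n (by omega)
    have m2 := hn.outA (by omega)
    have m3 : 0 < A.h (B.f n) := by omega
    have m4 := T.CA.h_f _ m3
    have m5 := T.AB.lineA.h_f _ m3
    have m6 := T.CA.h_f (A.f (B.f n)) (by omega)
    rw [v1, T.AB.lineB.ef _ v3, ← v1]
    omega
  have pC : Crit C B p := T.CB.crit_of_in (fun h => (hCe h).2) hBe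
  refine ⟨pC, fun h => ?_⟩
  have f1 := T.CA.h_f p h
  have f2 := T.CA.t_f p h
  have f3 := hp.outB h
  refine T.CB.crit_of_in (fun h' => ?_) (fun h' => ?_)
  · have g0 : 0 < C.t p := by omega
    obtain ⟨g1, g2⟩ := hCe g0
    have g3 : 0 < A.h (C.e p) := by rw [T.AC.h_e p g0]; exact h
    have g4 := g1.outA g3
    have g5 := T.AB.AB.lab_f _ g3
    have g6 := T.AB.AB.lab_f p h
    rw [T.CA.ef p g0 h]
    omega
  · have g0 : 0 < B.t p := by omega
    have g1 := hp.inA g0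
    have g2 := T.AB.lineB.fe p g0
    have g3 := T.AB.lineB.h_e p g0
    have g4 := T.AB.lineB.h_nonneg p
    obtain ⟨g5, g6⟩ := T.AB.BA.sq_f (B.e p) (by omega) (by omega) (by rw [g2, g1])
    rw [g2] at g6
    rw [g6, T.AB.lineB.ef _ (by omega), T.CA.h_f _ (by omega), hBe g0, ← g6, f1]

/-- One half of the statement that `f_B f_C f_A f_B` preserves bicritical vertices. -/
lemma BiCrit.crit_BCAB (T : Triple A B C) {x : V} (H : BiCrit A B C x) (N : PreCrit A B C x)
    (hh : 0 < B.h x) :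
    Crit C B (B.f (C.f (A.f (B.f x)))) ∧ 0 < C.h (A.f (B.f x)) ∧
      0 < B.h (C.f (A.f (B.f x))) ∧
      B.h (B.f (C.f (A.f (B.f x)))) = B.h x - 1 ∧ C.h (B.f (C.f (A.f (B.f x)))) = C.h x ∧
      B.t (B.f (C.f (A.f (B.f x)))) = B.t x + 1 ∧ C.t (B.f (C.f (A.f (B.f x)))) = C.t x := by
  obtain ⟨hpC, -⟩ := H.crit_AB T N hh
  obtain ⟨hyA, hp, p1, p2, p3, p4⟩ := T.AB.swap.crit_f H.critA.swap hh
  have y1 := H.critC.outB hh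
  have y2 := T.CB.BA.lab_f x hh
  have p5 := T.CA.h_f _ hyA
  have p6 := T.CA.t_f _ hyA
  have hC := T.CB.lineA.h_nonneg x
  obtain ⟨h1, h2, h3⟩ := T.CB.crit_f hpC (by omega)
  refine ⟨h2, by omega, h1, ?_⟩
  omega

lemma BiCrit.crit_eC_BCAB (T : Triple A B C) {x : V} (H : BiCrit A B C x)
    (N : PreCrit A B C x) (hh : 0 < B.h x) (h : 0 < C.t (B.f (C.f (A.f (B.f x))))) :
    Crit A B (C.e (B.f (C.f (A.f (B.f x))))) := by
  have H' := H.swap T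
  obtain ⟨hwC, w0, hrB, w1, w2, w3, w4⟩ := H.crit_BCAB T N hh
  obtain ⟨hwA, -, -, -, w5, -, w6⟩ := H'.crit_BCAB T.swap N.swap hh
  obtain ⟨hpC, -⟩ := H.crit_AB T N hh
  obtain ⟨hyA, hp, p1, p2, p3, p4⟩ := T.AB.swap.crit_f H.critA.swap hh
  obtain ⟨hyC, -⟩ := T.CB.swap.crit_f H.critC.swap hh
  have comm := T.AC.ff _ hyA hyC
  rw [comm] at hwA w5 w6
  have y4 := H.critC.outB hh
  set y := B.f x with y_def
  have p5 := T.CA.t_f y hyA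
  set p := A.f y with p_def
  set r := C.f p with r_def
  set w := B.f r with w_def
  have h1 : 0 < C.t p := by omega
  have h2 := hwC.inA h
  refine T.AB.crit_of_lineB (fun _ => ?_) (fun h3 => ?_)
  · -- `e_C w = f_B f_B f_C e_B e_C p`, and both `B`-edges are labeled `0`
    obtain ⟨d1, hd, d2, d3, d4, d5⟩ := T.CB.crit_e hpC h1
    have hep : Crit A B (C.e p) := by
      have k0 : 0 < C.t x := by omega
      have k1 : 0 < C.t y := by omega
      have k2 := (H.swap T).crit_e k0
      have k3 := H.critC.inA k0
      have k4 := T.CB.lineA.h_e x k0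
      have k5 := T.CB.lineA.h_nonneg x
      have k6 := T.CB.lineA.fe x k0
      obtain ⟨k7, k8⟩ := T.CB.AB.sq_f (C.e x) (by omega) (by omega) (by rw [k6, k3])
      rw [k6, ← y_def] at k8
      have k9 : C.e y = B.f (C.e x) := by rw [k8, T.CB.lineA.ef _ (by omega)]
      rw [p_def, T.CA.ef y k1 hyA, k9]
      exact (T.AB.swap.crit_f k2.swap (by omega)).2.1.swap
    have d6 := hep.inB d1
    have d7 := T.AC.h_e p h1
    have d8 := T.CB.lineB.fe _ d1
    have d9 := T.CB.lineA.fe _ h1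
    set d := B.e (C.e p) with d_def
    have Bp := T.CB.lineB.h_nonneg p
    obtain ⟨v1, v2, -⟩ := T.vermaC d (by omega) (by omega) (hd.outA (by omega))
      (hd.outB (by omega))
    rw [d8, d9, ← r_def, ← w_def] at v1
    have e1 : C.e w = B.f (B.f (C.f d)) := by rw [← v1, T.CB.lineA.ef _ v2]
    have s1 := T.AC.h_f d (by omega)
    have s2 := T.CB.AB.lab_f d (by omega)
    have s3 := hd.outA (by omega)
    have s4 : 0 < B.h (C.f d) := by omega
    have s5 := T.AB.lineB.h_f _ s4
    have s6 := T.AB.BA.lab_f _ s4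
    have s7 := T.AB.BA.lab_f (B.f (C.f d)) (by omega)
    have s8 := T.AC.h_e w h
    rw [e1] at s8 ⊢
    rw [T.AB.lineB.ef _ (by omega)]
    omega
  · have h4 := T.CB.lineA.fe w h
    have h5 := T.CB.lineA.h_e w h
    have h6 := T.CB.lineA.h_nonneg w
    obtain ⟨h7, h8⟩ := T.CB.AB.sq_f (C.e w) (by omega) h3 (by rw [h4, h2])
    rw [h4] at h8
    have h9 := T.AC.t_f _ (show 0 < C.h (B.f (C.e w)) by omega)
    rw [← h8, hwA.outB (by omega)] at h9
    rw [← h9, T.AC.t_e w h]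

/-- The string `f_B f_C f_A f_B` preserves bicritical vertices. -/
lemma BiCrit.string_BCAB (T : Triple A B C) {x : V} (H : BiCrit A B C x)
    (N : PreCrit A B C x) (hh : 0 < B.h x) :
    BiCrit A B C (B.f (C.f (A.f (B.f x)))) ∧ PreCrit A B C (B.f (C.f (A.f (B.f x)))) ∧
      A.h (B.f (C.f (A.f (B.f x)))) = A.h x ∧ B.h (B.f (C.f (A.f (B.f x)))) = B.h x - 1 ∧
      C.h (B.f (C.f (A.f (B.f x)))) = C.h x ∧ A.t (B.f (C.f (A.f (B.f x)))) = A.t x ∧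
      B.t (B.f (C.f (A.f (B.f x)))) = B.t x + 1 ∧ C.t (B.f (C.f (A.f (B.f x)))) = C.t x := by
  have H' := H.swap T
  have N' := N.swap
  obtain ⟨hwC, w0, hrB, w1, w2, w3, w4⟩ := H.crit_BCAB T N hh
  obtain ⟨hwA, w0', hrB', -, w5, -, w6⟩ := H'.crit_BCAB T.swap N' hh
  obtain ⟨hpC, hpA⟩ := H.crit_AB T N hh
  obtain ⟨hqA, -⟩ := H'.crit_AB T.swap N' hh
  obtain ⟨hyA, hp, p1, p2, p3, p4⟩ := T.AB.swap.crit_f H.critA.swap hh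
  obtain ⟨hyC, hq, q1, q2, q3, q4⟩ := T.CB.swap.crit_f H.critC.swap hh
  have comm := T.AC.ff _ hyA hyC
  rw [comm] at hwA hrB' w5 w6
  have r1 := T.AC.h_f _ w0
  have r2 := T.AC.t_f _ w0
  have y3 := H.critA.outB hh
  have y4 := H.critC.outB hh
  have y5 := T.AB.BA.lab_f x hh
  have y6 := T.AB.lineA.h_f _ hyA
  set y := B.f x with y_def
  have p5 := T.CA.t_f y hyA
  set p := A.f y with p_def
  set r := C.f p with r_def
  set w := B.f r with w_def
  have er : B.e w = r := T.AB.lineB.ef r hrB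
  have hN : PreCrit A B C w := by
    refine ⟨fun _ => ?_, fun _ => ?_⟩
    · rw [er, ← comm, T.AB.lineA.ef _ w0']
      exact hq.swap
    · rw [er, r_def, T.CB.lineA.ef _ w0]
      exact hp.swap
  have hwf : 0 < A.h w → Crit C B (A.f w) := by
    intro h
    have h1 : 0 < A.h p := by omega
    have h0 : 0 < A.h r := by omega
    obtain ⟨-, h2⟩ := T.AB.BA.sq_f r hrB h0 (by rw [← w_def]; omega)
    have h3 : 0 < C.h (A.f p) := by rw [T.CA.h_f p h1]; exact w0
    have h4 := (T.CB.crit_f (hpA h1) h3).2.1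
    rw [h2, r_def, T.AC.ff p h1 w0]
    exact h4
  have hwe : 0 < A.t w → Crit C B (A.e w) := by
    have := H'.crit_eC_BCAB T.swap N' hh
    rwa [comm] at this
  refine ⟨⟨hwA, hwC, hwe, hwf⟩, hN, ?_⟩
  omega
lemma BiCrit.of_source (T : Triple A B C) {x : V} (hA : A.t x = 0) (hB : B.t x = 0)
    (hC : C.t x = 0) : BiCrit A B C x := by
  refine ⟨T.AB.crit_of_in (fun h => by omega) (fun h => by omega),
    T.CB.crit_of_in (fun h => by omega) (fun h => by omega), fun h => by omega, fun h => ?_⟩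
  have h1 := T.AB.AB.lab_f x h
  have h2 := T.CA.t_f x h
  have h3 := T.AB.lineB.t_nonneg (A.f x)
  exact T.CB.crit_of_in (fun h => by omega) (fun h => by omega)

lemma PreCrit.of_t_eq_zero {x : V} (hB : B.t x = 0) : PreCrit A B C x :=
  ⟨fun h => by omega, fun h => by omega⟩

/-- From a critical vertex one can go back to a source of the two-colored component. -/
lemma Pair.exists_source_of_crit (P : Pair A B) (S : V → Prop)
    (hA : ∀ x, S x → 0 < A.t x → S (A.e x)) (hB : ∀ x, S x → 0 < B.t x → S (B.e x)) {x : V}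
    (hx : S x) (H : Crit A B x) :
    ∃ m, S m ∧ A.t m = 0 ∧ B.t m = 0 ∧ A.h m = A.h x + B.t x ∧ B.h m = B.h x + A.t x := by
  have hAt := P.lineA.t_nonneg x
  have hBt := P.lineB.t_nonneg x
  induction hn : (A.t x + B.t x).toNat using Nat.strong_induction_on generalizing x with
  | _ n ih =>
    by_cases h1 : 0 < A.t x
    · obtain ⟨h2, h3, h4⟩ := P.crit_e H h1
      obtain ⟨m, h5⟩ := ih _ (by omega) (hB _ (hA _ hx h1) h2) h3 (P.lineA.t_nonneg _)
        (P.lineB.t_nonneg _) rfl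
      exact ⟨m, h5.1, by omega⟩
    by_cases h1' : 0 < B.t x
    · obtain ⟨h2, h3, h4⟩ := P.swap.crit_e H.swap h1'
      obtain ⟨m, h5⟩ := ih _ (by omega) (hA _ (hB _ hx h1') h2) h3.swap (P.lineA.t_nonneg _)
        (P.lineB.t_nonneg _) rfl
      exact ⟨m, h5.1, by omega⟩
    exact ⟨x, hx, by omega⟩

/-- A step backwards along an edge of color `A` or `B`. -/
def Back (A B : ColorOps V) (x y : V) : Prop :=
  (0 < A.t x ∧ A.e x = y) ∨ (0 < B.t x ∧ B.e x = y)

/-- Backward steps are locally confluent. -/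
lemma Pair.back_join (P : Pair A B) (W : Verma A.dual B.dual) {x y z : V} (hy : Back A B x y)
    (hz : Back A B x z) : Relation.Join (Relation.ReflTransGen (Back A B)) y z := by
  have stepA : ∀ {u : V}, 0 < A.t u → Relation.ReflTransGen (Back A B) u (A.e u) :=
    fun h => .single (.inl ⟨h, rfl⟩)
  have stepB : ∀ {u : V}, 0 < B.t u → Relation.ReflTransGen (Back A B) u (B.e u) :=
    fun h => .single (.inr ⟨h, rfl⟩)
  have key : 0 < A.t x → 0 < B.t x →
      Relation.Join (Relation.ReflTransGen (Back A B)) (A.e x) (B.e x) := by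
    intro hA hB
    have lA := P.AB.lab_e x hA
    have lB := P.BA.lab_e x hB
    by_cases h1 : B.t (A.e x) = B.t x
    · obtain ⟨h2, h3⟩ := P.AB.sq_e x hA hB h1
      exact ⟨B.e (A.e x), stepB (by omega), h3 ▸ stepA (by omega)⟩
    by_cases h1' : A.t (B.e x) = A.t x
    · obtain ⟨h2, h3⟩ := P.BA.sq_e x hB hA h1'
      exact ⟨A.e (B.e x), h3 ▸ stepB (by omega), stepA (by omega)⟩
    obtain ⟨h2, h3, h4⟩ := W x hA hB (show B.h (A.e x) = B.h x by omega)
      (show A.h (B.e x) = A.h x by omega)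
    change A.e (B.e (B.e (A.e x))) = B.e (A.e (A.e (B.e x))) at h2
    have a1 := P.lineB.t_e (A.e x) (by omega)
    have a2 := P.lineA.t_e (B.e x) (by omega)
    refine ⟨A.e (B.e (B.e (A.e x))), ?_, ?_⟩
    · exact ((stepB (by omega)).trans (stepB (by omega))).trans (stepA h3)
    · rw [h2]
      exact ((stepA (by omega)).trans (stepA (by omega))).trans (stepB h4)
  rcases hy with ⟨h1, rfl⟩ | ⟨h1, rfl⟩ <;> rcases hz with ⟨h2, rfl⟩ | ⟨h2, rfl⟩
  · exact ⟨_, .refl, .refl⟩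
  · exact key h1 h2
  · obtain ⟨w, h3, h4⟩ := key h2 h1
    exact ⟨w, h4, h3⟩
  · exact ⟨_, .refl, .refl⟩

lemma Pair.wellFounded_back [Finite V] (P : Pair A B) :
    WellFounded (Function.swap (Back A B)) := by
  obtain ⟨M, hM⟩ := (Set.finite_range
    fun x => (A.h x - A.t x) + (B.h x - B.t x)).bddAbove
  refine Subrelation.wf ?_
    (measure fun x => (M - ((A.h x - A.t x) + (B.h x - B.t x))).toNat).wf
  intro y x hy
  have h0 : (A.h y - A.t y) + (B.h y - B.t y) ≤ M := hM ⟨y, rfl⟩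
  change Int.toNat _ < Int.toNat _
  rcases hy with ⟨h1, rfl⟩ | ⟨h1, rfl⟩
  · have := P.lineA.h_e x h1
    have := P.lineA.t_e x h1
    have := P.AB.lab_e x h1
    omega
  · have := P.lineB.h_e x h1
    have := P.lineB.t_e x h1
    have := P.BA.lab_e x h1
    omega

lemma Pair.exists_source [Finite V] (P : Pair A B) (x : V) :
    ∃ m, Relation.ReflTransGen (Back A B) x m ∧ A.t m = 0 ∧ B.t m = 0 := by
  induction x using P.wellFounded_back.induction with
  | _ x ih =>
    by_cases hx : ∃ y, Back A B x y
    · obtain ⟨y, hy⟩ := hx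
      obtain ⟨m, hm, hm'⟩ := ih y hy
      exact ⟨m, .head hy hm, hm'⟩
    · have hA := P.lineA.t_nonneg x
      have hB := P.lineB.t_nonneg x
      have hA' : ¬ 0 < A.t x := fun h => hx ⟨_, .inl ⟨h, rfl⟩⟩
      have hB' : ¬ 0 < B.t x := fun h => hx ⟨_, .inr ⟨h, rfl⟩⟩
      exact ⟨x, .refl, by omega⟩

/-- A vertex leads back to at most one source of its two-colored component. -/
lemma Pair.source_unique [Finite V] (P : Pair A B) (W : Verma A.dual B.dual) {x m n : V}
    (hm : Relation.ReflTransGen (Back A B) x m) (hmA : A.t m = 0) (hmB : B.t m = 0)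
    (hn : Relation.ReflTransGen (Back A B) x n) (hnA : A.t n = 0) (hnB : B.t n = 0) :
    m = n := by
  have stuck : ∀ {u w : V}, A.t u = 0 → B.t u = 0 → Relation.ReflTransGen (Back A B) u w →
      u = w := by
    intro u w h1 h2 h3
    rcases h3.cases_head with h | ⟨z, ⟨h, -⟩ | ⟨h, -⟩, -⟩
    · exact h
    · omega
    · omega
  induction x using P.wellFounded_back.induction generalizing m n with
  | _ x ih =>
    rcases hm.cases_head with rfl | ⟨y, hy, hym⟩
    · exact stuck hmA hmB hn
    rcases hn.cases_head with rfl | ⟨z, hz, hzn⟩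
    · exact (stuck hnA hnB hm).symm
    obtain ⟨w, hyw, hzw⟩ := P.back_join W hy hz
    obtain ⟨k, hk, hkA, hkB⟩ := P.exists_source w
    exact (ih y hy hym hmA hmB (hyw.trans hk) hkA hkB).trans
      (ih z hz (hzw.trans hk) hkA hkB hzn hnA hnB)

/-- A linear combination of the weights that is constant along edges of colors `A` and `B`. -/
def charge (A B C : ColorOps V) (x : V) : ℤ :=
  (A.h x - A.t x) + 2 * (B.h x - B.t x) + 3 * (C.h x - C.t x)

lemma Triple.charge_fA (T : Triple A B C) {x : V} (hh : 0 < A.h x) :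
    charge A B C (A.f x) = charge A B C x := by
  have := T.AB.lineA.h_f x hh
  have := T.AB.lineA.t_f x hh
  have := T.AB.AB.lab_f x hh
  have := T.CA.h_f x hh
  have := T.CA.t_f x hh
  unfold charge
  omega

lemma Triple.charge_fB (T : Triple A B C) {x : V} (hh : 0 < B.h x) :
    charge A B C (B.f x) = charge A B C x := by
  have := T.AB.lineB.h_f x hh
  have := T.AB.lineB.t_f x hh
  have := T.AB.BA.lab_f x hh
  have := T.CB.BA.lab_f x hh
  unfold charge
  omega

end ColorOps
/-! ### The operators of a crystal -/

lemma optIter_add {V : Type} (f : V → Option V) (m k : ℕ) (v : V) :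
    optIter f (m + k) v = (optIter f m v).bind (optIter f k) := by
  induction m generalizing v with
  | zero => simp [optIter]
  | succ m ih =>
    rw [Nat.add_right_comm]
    simp only [optIter]
    cases f v with
    | none => rfl
    | some w => simpa using ih w

lemma optIter_one {V : Type} (f : V → Option V) (v : V) : optIter f 1 v = f v := by
  simp only [optIter]
  cases f v <;> rfl

/-- Without cycles, a path has fewer edges than there are vertices. -/
lemma lt_card_of_optIter {V : Type} [Finite V] {f : V → Option V}
    (hf : ∀ v k, 0 < k → optIter f k v ≠ some v) {k : ℕ} {u v : V}
    (h : optIter f k u = some v) : k < Nat.card V := by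
  have hsome : ∀ j : Fin (k + 1), ∃ w, optIter f j u = some w := by
    intro j
    have h1 := optIter_add f j (k - j) u
    rw [Nat.add_sub_cancel' (Nat.lt_succ_iff.mp j.2), h] at h1
    obtain ⟨w, hw, -⟩ := Option.bind_eq_some_iff.mp h1.symm
    exact ⟨w, hw⟩
  choose p hp using hsome
  have key : ∀ i j : Fin (k + 1), i < j → p i ≠ p j := by
    intro i j hij heq
    have h1 := optIter_add f i (j - i) u
    rw [Nat.add_sub_cancel' hij.le, hp, hp, heq] at h1
    exact hf (p j) (j - i) (Nat.sub_pos_of_lt hij) h1.symm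
  have hinj : Function.Injective p := by
    intro i j hij
    rcases lt_trichotomy i j with h1 | h1 | h1
    · exact absurd hij (key i j h1)
    · exact h1
    · exact absurd hij.symm (key j i h1)
  have := Nat.card_le_card_of_injective p hinj
  simpa using this

namespace IsColored

variable {K : PreGraph} {C : Set ℕ}

lemma le_h_iff (hK : IsColored K C) {i k : ℕ} {v : K.V} :
    k ≤ K.h i v ↔ (optIter (K.F i) k v).isSome := by
  obtain ⟨hfin, -, -, hcyc⟩ := hK
  have hbdd : BddAbove {k | (optIter (K.F i) k v).isSome = true} := by
    refine ⟨Nat.card K.V, fun k hk => ?_⟩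
    obtain ⟨w, hw⟩ := Option.isSome_iff_exists.mp hk
    exact (lt_card_of_optIter (hcyc i) hw).le
  refine ⟨fun hk => ?_, fun hk => le_csSup hbdd hk⟩
  have h1 : (optIter (K.F i) (K.h i v) v).isSome = true :=
    Nat.sSup_mem (s := {k | (optIter (K.F i) k v).isSome = true}) ⟨0, rfl⟩ hbdd
  rw [← Nat.add_sub_cancel' hk, optIter_add] at h1
  cases h2 : optIter (K.F i) k v with
  | none => simp [h2] at h1
  | some w => rfl

lemma le_t_iff (hK : IsColored K C) {i k : ℕ} {v : K.V} :
    k ≤ K.t i v ↔ ∃ u, optIter (K.F i) k u = some v := by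
  obtain ⟨hfin, -, -, hcyc⟩ := hK
  have hbdd : BddAbove {k | ∃ u, optIter (K.F i) k u = some v} := by
    refine ⟨Nat.card K.V, fun k hk => ?_⟩
    obtain ⟨w, hw⟩ := hk
    exact (lt_card_of_optIter (hcyc i) hw).le
  refine ⟨fun hk => ?_, fun hk => le_csSup hbdd hk⟩
  obtain ⟨u, hu⟩ : ∃ u, optIter (K.F i) (K.t i v) u = some v :=
    Nat.sSup_mem (s := {k | ∃ u, optIter (K.F i) k u = some v}) ⟨0, v, rfl⟩ hbdd
  rw [← Nat.sub_add_cancel hk, optIter_add] at hu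
  obtain ⟨w, -, hw⟩ := Option.bind_eq_some_iff.mp hu
  exact ⟨w, hw⟩

lemma h_eq_of_edge (hK : IsColored K C) {i : ℕ} {u v : K.V} (he : K.F i u = some v) :
    K.h i u = K.h i v + 1 := by
  have key : ∀ k, k + 1 ≤ K.h i u ↔ k ≤ K.h i v := by
    intro k
    rw [hK.le_h_iff, hK.le_h_iff, optIter, he, Option.bind_some]
  have h1 := key (K.h i v)
  have h2 := key (K.h i v + 1)
  omega

lemma t_eq_of_edge (hK : IsColored K C) {i : ℕ} {u v : K.V} (he : K.F i u = some v) :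
    K.t i v = K.t i u + 1 := by
  have key : ∀ k, k + 1 ≤ K.t i v ↔ k ≤ K.t i u := by
    intro k
    rw [hK.le_t_iff, hK.le_t_iff]
    refine exists_congr fun w => ?_
    rw [optIter_add, Option.bind_eq_some_iff]
    constructor
    · rintro ⟨x, h1, h2⟩
      rw [optIter_one] at h2
      rwa [hK.2.2.1 i u x v he h2]
    · exact fun h => ⟨u, h, by rwa [optIter_one]⟩
  have h1 := key (K.t i u)
  have h2 := key (K.t i u + 1)
  omega

lemma exists_edge_of_h_pos (hK : IsColored K C) {i : ℕ} {u : K.V} (h : 0 < K.h i u) :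
    ∃ v, K.F i u = some v := by
  have h1 := hK.le_h_iff.mp (Nat.succ_le_of_lt h)
  rwa [Nat.succ_eq_add_one, zero_add, optIter_one, Option.isSome_iff_exists] at h1

lemma exists_edge_of_t_pos (hK : IsColored K C) {i : ℕ} {v : K.V} (h : 0 < K.t i v) :
    ∃ u, K.F i u = some v := by
  obtain ⟨u, hu⟩ := hK.le_t_iff.mp (Nat.succ_le_of_lt h)
  rw [Nat.succ_eq_add_one, zero_add, optIter_one] at hu
  exact ⟨u, hu⟩

lemma finv_eq_some_iff (hK : IsColored K C) {i : ℕ} {u v : K.V} :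
    K.Finv i v = some u ↔ K.F i u = some v := by
  unfold PreGraph.Finv
  constructor
  · intro h
    split_ifs at h with h1
    rw [← Option.some.inj h]
    exact h1.choose_spec
  · intro h
    have h1 : ∃ u, K.F i u = some v := ⟨u, h⟩
    rw [dif_pos h1, hK.2.2.1 i _ _ v h1.choose_spec h]

end IsColored

/-- The operators of color `i` of a graph, extended by the identity to total functions. -/
noncomputable def PreGraph.ops (K : PreGraph) (i : ℕ) : ColorOps K.V where
  f v := (K.F i v).getD v
  e v := (K.Finv i v).getD v
  h v := K.h i v
  t v := K.t i v

namespace IsColored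

variable {K : PreGraph} {C : Set ℕ}

lemma ops_of_edge (hK : IsColored K C) {i : ℕ} {u v : K.V} (he : K.F i u = some v) :
    0 < (K.ops i).h u ∧ 0 < (K.ops i).t v ∧ (K.ops i).f u = v ∧ (K.ops i).e v = u := by
  have h1 := hK.h_eq_of_edge he
  have h2 := hK.t_eq_of_edge he
  simp [PreGraph.ops, he, hK.finv_eq_some_iff.mpr he, h1, h2]

lemma edge_f (hK : IsColored K C) {i : ℕ} {u : K.V} (h : 0 < (K.ops i).h u) :
    K.F i u = some ((K.ops i).f u) := by
  obtain ⟨v, hv⟩ := hK.exists_edge_of_h_pos (Int.natCast_pos.mp h)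
  rw [(hK.ops_of_edge hv).2.2.1, hv]

lemma edge_e (hK : IsColored K C) {i : ℕ} {v : K.V} (h : 0 < (K.ops i).t v) :
    K.F i ((K.ops i).e v) = some v := by
  obtain ⟨u, hu⟩ := hK.exists_edge_of_t_pos (Int.natCast_pos.mp h)
  rw [(hK.ops_of_edge hu).2.2.2, hu]

lemma isLine (hK : IsColored K C) (i : ℕ) : (K.ops i).IsLine where
  h_nonneg _ := Int.natCast_nonneg _
  t_nonneg _ := Int.natCast_nonneg _
  ef v h := (hK.ops_of_edge (hK.edge_f h)).2.2.2
  fe v h := (hK.ops_of_edge (hK.edge_e h)).2.2.1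
  h_f v h := by have := hK.h_eq_of_edge (hK.edge_f h); simp only [PreGraph.ops] at *; omega
  t_f v h := by have := hK.t_eq_of_edge (hK.edge_f h); simp only [PreGraph.ops] at *; omega
  h_e v h := by have := hK.h_eq_of_edge (hK.edge_e h); simp only [PreGraph.ops] at *; omega
  t_e v h := by have := hK.t_eq_of_edge (hK.edge_e h); simp only [PreGraph.ops] at *; omega

/-- The relation between labels of both kinds along an edge. -/
lemma label {i j : ℕ} (hA2 : A2at K i j) (hij : Neighb i j) {u v : K.V} (he : K.F i u = some v) :
    ((K.ops j).h v = (K.ops j).h u ∧ (K.ops j).t v = (K.ops j).t u - 1) ∨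
      ((K.ops j).t v = (K.ops j).t u ∧ (K.ops j).h v = (K.ops j).h u + 1) := by
  obtain ⟨h1, h2, h3⟩ := hA2.1 u v he
  rw [if_pos hij] at h3
  simp only [PreGraph.ops]
  omega

lemma acts (hK : IsColored K C) {i j : ℕ} (hij : Neighb i j) (hA2 : A2at K i j)
    (hA2' : A2at K j i) (hA3 : A3at K i j) : ColorOps.Acts (K.ops i) (K.ops j) where
  lab_f v h := label hA2 hij (hK.edge_f h)
  lab_e v h := by have := label hA2 hij (hK.edge_e h); omega
  conv_f v h h' heq := by
    have h1 := label hA2 hij (hK.edge_f h)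
    have h2 := label hA2 hij (hK.edge_f h')
    have h3 := hA2.2 _ _ _ (hK.edge_f h) (hK.edge_f h')
    simp only [PreGraph.ops] at *
    omega
  conv_e v h h' heq := by
    have h1 := label hA2 hij (hK.edge_e h)
    have h2 := label hA2 hij (hK.edge_e h')
    have h3 := hA2.2 _ _ _ (hK.edge_e h') (hK.edge_e h)
    simp only [PreGraph.ops] at *
    omega
  sq_f v h h' heq := by
    obtain ⟨h1, w, h2, h3⟩ := hA3.1 _ _ _ (hK.edge_f h) (hK.edge_f h') (Int.ofNat.inj heq)
    rw [(hK.ops_of_edge h2).2.2.1, (hK.ops_of_edge h3).2.2.1]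
    exact ⟨by rw [← sub_eq_iff_eq_add']; exact h1, rfl⟩
  sq_e v h h' heq := by
    have h0 := label hA2 hij (hK.edge_e h)
    have h0' := label hA2' hij.symm (hK.edge_e h')
    obtain ⟨h1, w, h2, h3⟩ := hA3.2 _ _ _ (hK.edge_e h) (hK.edge_e h')
      (by simp only [PreGraph.ops] at *; omega)
    rw [(hK.ops_of_edge h2).2.2.2, (hK.ops_of_edge h3).2.2.2]
    exact ⟨by simp only [PreGraph.ops] at *; omega, rfl⟩

lemma verma (hK : IsColored K C) {i j : ℕ} (hij : Neighb i j) (hA2 : A2at K i j)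
    (hA2' : A2at K j i) (hA4 : A4at K i j) : ColorOps.Verma (K.ops i) (K.ops j) := by
  intro v h h' heq heq'
  have h0 := label hA2 hij (hK.edge_f h)
  have h0' := label hA2' hij.symm (hK.edge_f h')
  obtain ⟨w, h1, h2⟩ := hA4.1 _ _ _ (hK.edge_f h) (hK.edge_f h')
    (by simp only [PreGraph.ops] at *; omega) (by simp only [PreGraph.ops] at *; omega)
  simp only [Option.bind_eq_some_iff] at h1 h2
  obtain ⟨a₃, ⟨a₂, ⟨a₁, ha₁, ha₂⟩, ha₃⟩, ha₄⟩ := h1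
  obtain ⟨b₃, ⟨b₂, ⟨b₁, hb₁, hb₂⟩, hb₃⟩, hb₄⟩ := h2
  rw [(hK.ops_of_edge ha₁).2.2.1, (hK.ops_of_edge ha₂).2.2.1, (hK.ops_of_edge ha₃).2.2.1,
    (hK.ops_of_edge ha₄).2.2.1, (hK.ops_of_edge hb₁).2.2.1, (hK.ops_of_edge hb₂).2.2.1,
    (hK.ops_of_edge hb₃).2.2.1, (hK.ops_of_edge hb₄).2.2.1]
  exact ⟨rfl, (hK.ops_of_edge ha₄).1, (hK.ops_of_edge hb₄).1⟩

lemma verma_dual (hK : IsColored K C) {i j : ℕ} (hA4 : A4at K i j) :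
    ColorOps.Verma (K.ops i).dual (K.ops j).dual := by
  intro v h h' heq heq'
  obtain ⟨w, h1, h2⟩ := hA4.2 _ _ _ (hK.edge_e h) (hK.edge_e h') (Int.ofNat.inj heq.symm)
    (Int.ofNat.inj heq'.symm)
  simp only [Option.bind_eq_some_iff, hK.finv_eq_some_iff] at h1 h2
  obtain ⟨a₃, ⟨a₂, ⟨a₁, ha₁, ha₂⟩, ha₃⟩, ha₄⟩ := h1
  obtain ⟨b₃, ⟨b₂, ⟨b₁, hb₁, hb₂⟩, hb₃⟩, hb₄⟩ := h2
  simp only [ColorOps.dual]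
  rw [(hK.ops_of_edge ha₁).2.2.2, (hK.ops_of_edge ha₂).2.2.2, (hK.ops_of_edge ha₃).2.2.2,
    (hK.ops_of_edge ha₄).2.2.2, (hK.ops_of_edge hb₁).2.2.2, (hK.ops_of_edge hb₂).2.2.2,
    (hK.ops_of_edge hb₃).2.2.2, (hK.ops_of_edge hb₄).2.2.2]
  exact ⟨rfl, (hK.ops_of_edge ha₄).2.1, (hK.ops_of_edge hb₄).2.1⟩

lemma distant (hK : IsColored K C) {i j : ℕ} (hij : Far i j) (hA2 : A2at K j i)
    (hA5 : A5at K i j) : ColorOps.Distant (K.ops i) (K.ops j) := by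
  have hlab : ∀ {u v : K.V}, K.F j u = some v → (K.ops i).h v = (K.ops i).h u ∧
      (K.ops i).t v = (K.ops i).t u := by
    intro u v he
    obtain ⟨h1, h2, h3⟩ := hA2.1 u v he
    rw [if_neg (by unfold Neighb; unfold Far at hij; omega)] at h3
    simp only [PreGraph.ops]
    omega
  have inv : ∀ {k : ℕ} {v : K.V}, 0 < (K.ops k).t v → K.Finv k v = some ((K.ops k).e v) :=
    fun h => hK.finv_eq_some_iff.mpr (hK.edge_e h)
  refine ⟨fun v h => (hlab (hK.edge_f h)).1, fun v h => (hlab (hK.edge_f h)).2,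
    fun v h => (hlab (hK.edge_e h)).1.symm, fun v h => (hlab (hK.edge_e h)).2.symm,
    fun v h h' => ?_, fun v h h' => ?_, fun v h h' => ?_, fun v h h' => ?_⟩
  · obtain ⟨w, h1, h2⟩ := hA5 _ (.inl rfl) _ (.inl rfl) v (by simp [hK.edge_f h])
      (by simp [hK.edge_f h'])
    rw [hK.edge_f h, Option.bind_some] at h1
    rw [hK.edge_f h', Option.bind_some] at h2
    rw [(hK.ops_of_edge h1).2.2.1, (hK.ops_of_edge h2).2.2.1]
  · obtain ⟨w, h1, h2⟩ := hA5 _ (.inl rfl) _ (.inr rfl) v (by simp [hK.edge_f h])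
      (by simp [inv h'])
    rw [hK.edge_f h, Option.bind_some, hK.finv_eq_some_iff] at h1
    rw [inv h', Option.bind_some] at h2
    rw [(hK.ops_of_edge h1).2.2.2, (hK.ops_of_edge h2).2.2.1]
  · obtain ⟨w, h1, h2⟩ := hA5 _ (.inr rfl) _ (.inl rfl) v (by simp [inv h])
      (by simp [hK.edge_f h'])
    rw [inv h, Option.bind_some] at h1
    rw [hK.edge_f h', Option.bind_some, hK.finv_eq_some_iff] at h2
    rw [(hK.ops_of_edge h1).2.2.1, (hK.ops_of_edge h2).2.2.2]
  · obtain ⟨w, h1, h2⟩ := hA5 _ (.inr rfl) _ (.inr rfl) v (by simp [inv h]) (by simp [inv h'])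
    rw [inv h, Option.bind_some, hK.finv_eq_some_iff] at h1
    rw [inv h', Option.bind_some, hK.finv_eq_some_iff] at h2
    rw [(hK.ops_of_edge h1).2.2.2, (hK.ops_of_edge h2).2.2.2]

end IsColored

namespace IsACrystal

variable {K : PreGraph}

lemma pair {n : ℕ} (hK : IsACrystal n K) {i j : ℕ} (hi : i ∈ Set.Icc 1 n)
    (hj : j ∈ Set.Icc 1 n) (hij : Neighb i j) : ColorOps.Pair (K.ops i) (K.ops j) := by
  obtain ⟨hc, -, hA2, hA34, -⟩ := hK
  have hne : i ≠ j := by unfold Neighb at hij; omega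
  exact ⟨hc.isLine i, hc.isLine j,
    hc.acts hij (hA2 i hi j hj hne) (hA2 j hj i hi hne.symm) (hA34 i hi j hj hij).1,
    hc.acts hij.symm (hA2 j hj i hi hne.symm) (hA2 i hi j hj hne) (hA34 j hj i hi hij.symm).1⟩

lemma triple (hK : IsACrystal 3 K) : ColorOps.Triple (K.ops 1) (K.ops 2) (K.ops 3) := by
  have m1 : 1 ∈ Set.Icc 1 3 := by simp
  have m2 : 2 ∈ Set.Icc 1 3 := by simp
  have m3 : 3 ∈ Set.Icc 1 3 := by simp
  have n12 : Neighb 1 2 := .inl rfl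
  have n32 : Neighb 3 2 := .inr rfl
  have f13 : Far 1 3 := .inl le_rfl
  have P := hK.pair m1 m2 n12
  have P' := hK.pair m3 m2 n32
  obtain ⟨hc, -, hA2, hA34, hA5⟩ := hK
  exact ⟨P, P', hc.distant f13 (hA2 3 m3 1 m1 (by simp)) (hA5 1 m1 3 m3 f13),
    hc.distant f13.symm (hA2 1 m1 3 m3 (by simp)) (hA5 3 m3 1 m1 f13.symm),
    hc.verma n12 (hA2 1 m1 2 m2 (by simp)) (hA2 2 m2 1 m1 (by simp)) (hA34 1 m1 2 m2 n12).2,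
    hc.verma n32 (hA2 3 m3 2 m2 (by simp)) (hA2 2 m2 3 m3 (by simp)) (hA34 3 m3 2 m2 n32).2⟩

end IsACrystal
/-! ### Principal vertices -/

lemma ColorOps.IsLine.eq_of_iterate_e {V : Type} {A : ColorOps V} (H : A.IsLine) {n : ℕ}
    {x y : V} (hx : A.t x = n) (hy : A.t y = n) (h : A.e^[n] x = A.e^[n] y) : x = y := by
  induction n generalizing x y with
  | zero => exact h
  | succ n ih =>
    push_cast at hx hy
    have h1 := ih (by rw [H.t_e x (by omega)]; omega) (by rw [H.t_e y (by omega)]; omega) h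
    rw [← H.fe x (by omega), h1, H.fe y (by omega)]

lemma applyStr_append (K : PreGraph) (L M : List ℕ) (x : K.V) :
    applyStr K (L ++ M) x = (applyStr K L x).bind (applyStr K M) := by
  induction L generalizing x with
  | nil => rfl
  | cons i L ih =>
    simp only [List.cons_append, applyStr]
    cases K.F i x with
    | none => rfl
    | some y => simpa using ih y

lemma applyStr_replicate_induction {K : PreGraph} {L : List ℕ} (P : ℕ → K.V → Prop)
    (hP : ∀ n x y, P n x → applyStr K L x = some y → P (n + 1) y) {n : ℕ} {x y : K.V}
    (hx : P 0 x) (h : applyStr K (List.replicate n L).flatten x = some y) : P n y := by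
  induction n generalizing y with
  | zero =>
    simp only [List.replicate_zero, List.flatten_nil, applyStr, Option.some.injEq] at h
    rwa [← h]
  | succ n ih =>
    rw [List.replicate_succ', List.flatten_append, applyStr_append,
      Option.bind_eq_some_iff] at h
    obtain ⟨z, h1, h2⟩ := h
    exact hP n z y (ih h1) (by simpa using h2)

lemma IsColored.applyStr_cons {K : PreGraph} {C : Set ℕ} (hK : IsColored K C) {i : ℕ}
    {L : List ℕ} {x y : K.V} (h : applyStr K (i :: L) x = some y) :
    0 < (K.ops i).h x ∧ applyStr K L ((K.ops i).f x) = some y := by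
  rw [applyStr, Option.bind_eq_some_iff] at h
  obtain ⟨z, h1, h2⟩ := h
  obtain ⟨h3, -, h4, -⟩ := hK.ops_of_edge h1
  exact ⟨h3, by rwa [h4]⟩

lemma prinStr_three (a : ℕ → ℕ) : prinStr 0 3 a =
    (List.replicate (a 1) [1, 2, 3]).flatten ++ ((List.replicate (a 2) [2, 1, 3, 2]).flatten ++
      (List.replicate (a 3) [3, 2, 1]).flatten) := by
  simp [prinStr, SStr, wStr, List.range_succ]

lemma prinStr_two (o : ℕ) (p : ℕ → ℕ) : prinStr o 2 p =
    (List.replicate (p (o + 1)) [o + 1, o + 2]).flatten ++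
      (List.replicate (p (o + 2)) [o + 2, o + 1]).flatten := by
  simp [prinStr, SStr, wStr, List.range_succ]

/-- The principal vertices of an `A_3`-crystal are bicritical. -/
lemma IsACrystal.biCrit_of_isPrin {K : PreGraph} (hK : IsACrystal 3 K) {s : K.V}
    (hs : IsSource K s) {a : ℕ → ℕ} {p : K.V} (hp : IsPrin K 0 3 s a p) :
    ColorOps.BiCrit (K.ops 1) (K.ops 2) (K.ops 3) p ∧
      (K.ops 1).h p = K.h 1 s - a 1 ∧ (K.ops 2).h p = K.h 2 s - a 2 ∧
      (K.ops 3).h p = K.h 3 s - a 3 ∧ (K.ops 1).t p = a 3 ∧ (K.ops 2).t p = a 2 ∧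
      (K.ops 3).t p = a 1 := by
  have T := hK.triple
  have hc := hK.1
  have ht : ∀ i, (K.ops i).t s = 0 := by
    intro i
    by_contra h
    exact hs i _ (hc.edge_e (lt_of_le_of_ne ((hc.isLine i).t_nonneg s) (Ne.symm h)))
  rw [IsPrin, prinOpt, prinStr_three, applyStr_append, Option.bind_eq_some_iff] at hp
  obtain ⟨x, hx, hp⟩ := hp
  rw [applyStr_append, Option.bind_eq_some_iff] at hp
  obtain ⟨y, hy, hp⟩ := hp
  have Hx := applyStr_replicate_induction (fun n x =>
      ColorOps.BiCrit (K.ops 1) (K.ops 2) (K.ops 3) x ∧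
      (K.ops 1).h x = K.h 1 s - n ∧ (K.ops 2).h x = K.h 2 s ∧
      (K.ops 3).h x = K.h 3 s ∧ (K.ops 1).t x = 0 ∧ (K.ops 2).t x = 0 ∧
      (K.ops 3).t x = n) (by
    rintro n u w ⟨H, h1⟩ hw
    obtain ⟨g1, hw⟩ := hc.applyStr_cons hw
    obtain ⟨g2, hw⟩ := hc.applyStr_cons hw
    obtain ⟨g3, hw⟩ := hc.applyStr_cons hw
    obtain rfl := Option.some.inj hw
    obtain ⟨H', h2⟩ := H.string_CBA T g1
    refine ⟨H', ?_⟩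
    push_cast
    omega) ⟨.of_source T (ht 1) (ht 2) (ht 3), (sub_zero _).symm, rfl, rfl, ht 1, ht 2, ht 3⟩ hx
  obtain ⟨Hx, x1, x2, x3, x4, x5, x6⟩ := Hx
  have Hy := applyStr_replicate_induction (fun n x =>
      ColorOps.BiCrit (K.ops 1) (K.ops 2) (K.ops 3) x ∧
      ColorOps.PreCrit (K.ops 1) (K.ops 2) (K.ops 3) x ∧
      (K.ops 1).h x = K.h 1 s - a 1 ∧ (K.ops 2).h x = K.h 2 s - n ∧
      (K.ops 3).h x = K.h 3 s ∧ (K.ops 1).t x = 0 ∧ (K.ops 2).t x = n ∧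
      (K.ops 3).t x = a 1) (by
    rintro n u w ⟨H, H', h1⟩ hw
    obtain ⟨g1, hw⟩ := hc.applyStr_cons hw
    obtain ⟨g2, hw⟩ := hc.applyStr_cons hw
    obtain ⟨g3, hw⟩ := hc.applyStr_cons hw
    obtain ⟨g4, hw⟩ := hc.applyStr_cons hw
    obtain rfl := Option.some.inj hw
    obtain ⟨N, N', h2⟩ := H.string_BCAB T H' g1
    refine ⟨N, N', ?_⟩
    push_cast
    omega) ⟨Hx, .of_t_eq_zero x5, x1, x2.trans (sub_zero _).symm, x3, x4, x5, x6⟩ hy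
  obtain ⟨Hy, -, y1, y2, y3, y4, y5, y6⟩ := Hy
  exact applyStr_replicate_induction (fun n x =>
      ColorOps.BiCrit (K.ops 1) (K.ops 2) (K.ops 3) x ∧
      (K.ops 1).h x = K.h 1 s - a 1 ∧ (K.ops 2).h x = K.h 2 s - a 2 ∧
      (K.ops 3).h x = K.h 3 s - n ∧ (K.ops 1).t x = n ∧ (K.ops 2).t x = a 2 ∧
      (K.ops 3).t x = a 1) (by
    rintro n u w ⟨H, h1⟩ hw
    obtain ⟨g1, hw⟩ := hc.applyStr_cons hw
    obtain ⟨g2, hw⟩ := hc.applyStr_cons hw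
    obtain ⟨g3, hw⟩ := hc.applyStr_cons hw
    obtain rfl := Option.some.inj hw
    obtain ⟨H', h2⟩ := (H.swap T).string_CBA T.swap g1
    refine ⟨H'.swap T.swap, ?_⟩
    push_cast
    omega) ⟨Hy, y1, y2, y3.trans (sub_zero _).symm, y4, y5, y6⟩ hp

/-- The line lengths at the principal vertices of a two-colored component. -/
lemma IsColored.ops_of_prinStr_two {K : PreGraph} {C : Set ℕ} (hK : IsColored K C) {o : ℕ}
    (P : ColorOps.Pair (K.ops (o + 1)) (K.ops (o + 2))) {s z : K.V}
    (h1 : (K.ops (o + 1)).t s = 0) (h2 : (K.ops (o + 2)).t s = 0) {p : ℕ → ℕ}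
    (hz : applyStr K (prinStr o 2 p) s = some z) :
    (K.ops (o + 1)).h z = (K.ops (o + 1)).h s - p (o + 1) ∧
      (K.ops (o + 2)).h z = (K.ops (o + 2)).h s - p (o + 2) ∧
      (K.ops (o + 1)).t z = p (o + 2) ∧ (K.ops (o + 2)).t z = p (o + 1) := by
  rw [prinStr_two, applyStr_append, Option.bind_eq_some_iff] at hz
  obtain ⟨x, hx, hz⟩ := hz
  have Hx := applyStr_replicate_induction (fun n x =>
      ColorOps.Crit (K.ops (o + 1)) (K.ops (o + 2)) x ∧
      (K.ops (o + 1)).h x = (K.ops (o + 1)).h s - n ∧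
      (K.ops (o + 2)).h x = (K.ops (o + 2)).h s ∧
      (K.ops (o + 1)).t x = 0 ∧ (K.ops (o + 2)).t x = n) (by
    rintro n u w ⟨H, h1⟩ hw
    obtain ⟨g1, hw⟩ := hK.applyStr_cons hw
    obtain ⟨g2, hw⟩ := hK.applyStr_cons hw
    obtain rfl := Option.some.inj hw
    obtain ⟨-, H', h2⟩ := P.crit_f H g1
    refine ⟨H', ?_⟩
    push_cast
    omega) ⟨P.crit_of_in (fun h => by omega) (fun h => by omega), (sub_zero _).symm, rfl, h1,
      h2⟩ hx
  obtain ⟨Hx, x1, x2, x3, x4⟩ := Hx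
  exact (applyStr_replicate_induction (fun n x =>
      ColorOps.Crit (K.ops (o + 1)) (K.ops (o + 2)) x ∧
      (K.ops (o + 1)).h x = (K.ops (o + 1)).h s - p (o + 1) ∧
      (K.ops (o + 2)).h x = (K.ops (o + 2)).h s - n ∧
      (K.ops (o + 1)).t x = n ∧ (K.ops (o + 2)).t x = p (o + 1)) (by
    rintro n u w ⟨H, h1⟩ hw
    obtain ⟨g1, hw⟩ := hK.applyStr_cons hw
    obtain ⟨g2, hw⟩ := hK.applyStr_cons hw
    obtain rfl := Option.some.inj hw
    obtain ⟨-, H', h2⟩ := P.swap.crit_f H.swap g1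
    refine ⟨H'.swap, ?_⟩
    push_cast
    omega) ⟨Hx, x1, x2.trans (sub_zero _).symm, x3, x4⟩ hz).2

/-! ### Components -/

lemma inComp.symm {K : PreGraph} {I : Set ℕ} {u v : K.V} (h : inComp K I u v) :
    inComp K I v u := by
  induction h with
  | refl => exact .refl
  | tail _ hs ih =>
    obtain ⟨i, hi, he⟩ := hs
    exact .head ⟨i, hi, he.symm⟩ ih

/-- Functions that are constant along the edges with colors in `I` are constant on components. -/
lemma inComp.eq_of_edges {K : PreGraph} {I : Set ℕ} {α : Type*} {g : K.V → α}
    (hg : ∀ i ∈ I, ∀ u w, K.F i u = some w → g w = g u) {x y : K.V} (h : inComp K I x y) :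
    g y = g x := by
  induction h with
  | refl => rfl
  | tail _ hs ih =>
    obtain ⟨i, hi, he | he⟩ := hs
    · rw [hg i hi _ _ he, ih]
    · rw [← hg i hi _ _ he, ih]

lemma sub_edge {K : PreGraph} {I : Set ℕ} {v : K.V} {i : ℕ} {u w : (K.sub I v).V} :
    (K.sub I v).F i u = some w ↔ i ∈ I ∧ K.F i u.1 = some w.1 := by
  obtain ⟨w, hw⟩ := w
  by_cases hi : i ∈ I
  · simp only [PreGraph.sub, hi, dif_pos, true_and, Option.pbind_eq_some_iff]
    constructor
    · rintro ⟨x, hx, h⟩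
      exact hx.trans (congrArg (fun u => some u.1) (Option.some.inj h))
    · exact fun h => ⟨w, h, rfl⟩
  · simp [PreGraph.sub, hi]

lemma applyStr_of_sub {K : PreGraph} {I : Set ℕ} {v : K.V} {L : List ℕ}
    {x y : (K.sub I v).V} (h : applyStr (K.sub I v) L x = some y) :
    applyStr K L x.1 = some y.1 := by
  induction L generalizing x with
  | nil => exact congrArg (fun u => some u.1) (Option.some.inj h)
  | cons i L ih =>
    rw [applyStr, Option.bind_eq_some_iff] at h
    obtain ⟨z, h1, h2⟩ := h
    rw [applyStr, (sub_edge.mp h1).2, Option.bind_some]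
    exact ih h2

namespace IsColored

variable {K : PreGraph} {C : Set ℕ}

lemma t_eq_zero_of_sub (hK : IsColored K C) {I : Set ℕ} {v : K.V} {s : (K.sub I v).V}
    (hs : IsSource (K.sub I v) s) {i : ℕ} (hi : i ∈ I) : (K.ops i).t s.1 = 0 := by
  by_contra h
  have he := hK.edge_e (lt_of_le_of_ne ((hK.isLine i).t_nonneg s.1) (Ne.symm h))
  exact hs i ⟨_, s.2.tail ⟨i, hi, .inr he⟩⟩ (sub_edge.mpr ⟨hi, he⟩)

lemma inComp_e (hK : IsColored K C) {I : Set ℕ} {i : ℕ} (hi : i ∈ I) {v x : K.V}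
    (hx : inComp K I v x) (h : 0 < (K.ops i).t x) : inComp K I v ((K.ops i).e x) :=
  hx.tail ⟨i, hi, .inr (hK.edge_e h)⟩

/-- A two-colored component has only one source. -/
lemma source_unique (hK : IsColored K C) {i j : ℕ} (P : ColorOps.Pair (K.ops i) (K.ops j))
    (W : ColorOps.Verma (K.ops i).dual (K.ops j).dual) {I : Set ℕ}
    (hI : ∀ k ∈ I, k = i ∨ k = j) {m n : K.V} (h : inComp K I m n)
    (hmi : (K.ops i).t m = 0) (hmj : (K.ops j).t m = 0)
    (hni : (K.ops i).t n = 0) (hnj : (K.ops j).t n = 0) : m = n := by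
  have : Finite K.V := hK.1
  have edge : ∀ k ∈ I, ∀ {u w : K.V}, K.F k u = some w →
      ColorOps.Back (K.ops i) (K.ops j) w u := by
    intro k hk u w he
    obtain ⟨-, h1, -, h2⟩ := hK.ops_of_edge he
    rcases hI k hk with rfl | rfl
    · exact .inl ⟨h1, h2⟩
    · exact .inr ⟨h1, h2⟩
  have key : ∀ y, inComp K I m y →
      Relation.ReflTransGen (ColorOps.Back (K.ops i) (K.ops j)) y m := by
    intro y hy
    induction hy with
    | refl => exact .refl
    | tail _ hs ih =>
      obtain ⟨k, hk, he | he⟩ := hs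
      · exact .head (edge k hk he) ih
      · obtain ⟨l, h1, h2, h3⟩ := P.exists_source _
        rwa [P.source_unique W ih hmi hmj (.head (edge k hk he) h1) h2 h3]
  exact P.source_unique W (key n h) hmi hmj .refl hni hnj

end IsColored

/-! ### The involution -/

section Involution

variable {K : PreGraph} {C : Set ℕ} {σ : K.V → K.V}

lemma optIter_involution (hσb : Function.Bijective σ)
    (hσ : ∀ (i : ℕ) (u v : K.V), K.F i u = some v ↔ K.F (4 - i) (σ u) = some (σ v))
    (i k : ℕ) (u : K.V) : optIter (K.F (4 - i)) k (σ u) = (optIter (K.F i) k u).map σ := by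
  induction k generalizing u with
  | zero => rfl
  | succ k ih =>
    simp only [optIter]
    cases h : K.F i u with
    | some w => simpa [(hσ i u w).mp h] using ih w
    | none =>
      cases h' : K.F (4 - i) (σ u) with
      | none => rfl
      | some w =>
        obtain ⟨w, rfl⟩ := hσb.2 w
        rw [(hσ i u w).mpr h'] at h
        cases h

lemma IsColored.h_involution (hK : IsColored K C) (hσb : Function.Bijective σ)
    (hσ : ∀ (i : ℕ) (u v : K.V), K.F i u = some v ↔ K.F (4 - i) (σ u) = some (σ v))
    (i : ℕ) (u : K.V) : (K.ops (4 - i)).h (σ u) = (K.ops i).h u := by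
  refine congrArg Nat.cast (eq_of_forall_le_iff fun k => ?_)
  rw [hK.le_h_iff, hK.le_h_iff, optIter_involution hσb hσ, Option.isSome_map]

lemma IsColored.t_involution (hK : IsColored K C) (hσb : Function.Bijective σ)
    (hσ : ∀ (i : ℕ) (u v : K.V), K.F i u = some v ↔ K.F (4 - i) (σ u) = some (σ v))
    (i : ℕ) (u : K.V) : (K.ops (4 - i)).t (σ u) = (K.ops i).t u := by
  refine congrArg Nat.cast (eq_of_forall_le_iff fun k => ?_)
  rw [hK.le_t_iff, hK.le_t_iff]
  constructor
  · rintro ⟨w, hw⟩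
    obtain ⟨w, rfl⟩ := hσb.2 w
    rw [optIter_involution hσb hσ, Option.map_eq_some_iff] at hw
    obtain ⟨x, hx, hxu⟩ := hw
    exact ⟨w, by rw [hx, hσb.1 hxu]⟩
  · rintro ⟨w, hw⟩
    exact ⟨σ w, by rw [optIter_involution hσb hσ, hw, Option.map_some]⟩

lemma stepOn_involution
    (hσ : ∀ (i : ℕ) (u v : K.V), K.F i u = some v ↔ K.F (4 - i) (σ u) = some (σ v))
    {u w : K.V} : stepOn K (Set.Icc 2 3) (σ u) (σ w) ↔ stepOn K (Set.Icc 1 2) u w := by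
  constructor
  · rintro ⟨i, ⟨hi, hi'⟩, h⟩
    refine ⟨4 - i, ⟨by omega, by omega⟩, ?_⟩
    rwa [hσ _ u w, hσ _ w u, show 4 - (4 - i) = i by omega]
  · rintro ⟨i, ⟨hi, hi'⟩, h⟩
    refine ⟨4 - i, ⟨by omega, by omega⟩, ?_⟩
    rwa [← hσ, ← hσ]

/-- The involution maps the upper component of `x` onto the lower component of `σ x`. -/
lemma inComp_involution (hσb : Function.Bijective σ)
    (hσ : ∀ (i : ℕ) (u v : K.V), K.F i u = some v ↔ K.F (4 - i) (σ u) = some (σ v))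
    {x y : K.V} : inComp K (Set.Icc 2 3) (σ x) (σ y) ↔ inComp K (Set.Icc 1 2) x y := by
  constructor
  · intro h
    generalize hz : σ y = z at h
    induction h generalizing y with
    | refl => rw [hσb.1 hz]; exact .refl
    | @tail z w _ hs ih =>
      obtain ⟨z, rfl⟩ := hσb.2 z
      rw [← hz] at hs
      exact (ih rfl).tail ((stepOn_involution hσ).mp hs)
  · exact fun h => h.lift σ fun _ _ => (stepOn_involution hσ).mpr

end Involution

namespace IsACrystal

variable {K : PreGraph}

lemma charge_upper (hK : IsACrystal 3 K) {x y : K.V} (h : inComp K (Set.Icc 1 2) x y) :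
    ColorOps.charge (K.ops 1) (K.ops 2) (K.ops 3) y =
      ColorOps.charge (K.ops 1) (K.ops 2) (K.ops 3) x := by
  refine h.eq_of_edges (g := ColorOps.charge _ _ _) fun i hi u w he => ?_
  rw [Set.mem_Icc] at hi
  obtain ⟨h1, -, rfl, -⟩ := hK.1.ops_of_edge he
  obtain rfl | rfl : i = 1 ∨ i = 2 := by omega
  · exact hK.triple.charge_fA h1
  · exact hK.triple.charge_fB h1

lemma charge_lower (hK : IsACrystal 3 K) {x y : K.V} (h : inComp K (Set.Icc 2 3) x y) :
    ColorOps.charge (K.ops 3) (K.ops 2) (K.ops 1) y =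
      ColorOps.charge (K.ops 3) (K.ops 2) (K.ops 1) x := by
  refine h.eq_of_edges (g := ColorOps.charge _ _ _) fun i hi u w he => ?_
  rw [Set.mem_Icc] at hi
  obtain ⟨h1, -, rfl, -⟩ := hK.1.ops_of_edge he
  obtain rfl | rfl : i = 2 ∨ i = 3 := by omega
  · exact hK.triple.swap.charge_fB h1
  · exact hK.triple.swap.charge_fA h1

/-- The difference of the weights of colors `1` and `3` is constant along `2`-lines. -/
lemma weight_sub_middle (hK : IsACrystal 3 K) {x y : K.V} (h : inComp K {2} x y) :
    ((K.ops 1).h y - (K.ops 1).t y) - ((K.ops 3).h y - (K.ops 3).t y) =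
      ((K.ops 1).h x - (K.ops 1).t x) - ((K.ops 3).h x - (K.ops 3).t x) := by
  refine h.eq_of_edges (g := fun y => ((K.ops 1).h y - (K.ops 1).t y) -
    ((K.ops 3).h y - (K.ops 3).t y)) fun i hi u w he => ?_
  obtain rfl : i = 2 := hi
  obtain ⟨h1, -, rfl, -⟩ := hK.1.ops_of_edge he
  have := hK.triple.AB.BA.lab_f u h1
  have := hK.triple.CB.BA.lab_f u h1
  omega

end IsACrystal

/-- A vertex of a line is determined by the difference of the lengths of its two parts. -/
lemma IsColored.eq_of_inComp_line {K : PreGraph} {C : Set ℕ} (hK : IsColored K C) {i : ℕ}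
    {x y : K.V} (h : inComp K {i} x y)
    (hw : (K.ops i).h x - (K.ops i).t x = (K.ops i).h y - (K.ops i).t y) : x = y := by
  have hl := hK.isLine i
  have h1 := h.eq_of_edges (g := fun y => (K.ops i).h y + (K.ops i).t y) fun j hj u w he => by
    obtain rfl : j = i := hj
    obtain ⟨h1, -, rfl, -⟩ := hK.ops_of_edge he
    have := hl.h_f u h1
    have := hl.t_f u h1
    omega
  have h2 := h.eq_of_edges (g := fun y => (K.ops i).e^[K.t i y] y) fun j hj u w he => by
    obtain rfl : j = i := hj
    obtain ⟨-, -, -, h2⟩ := hK.ops_of_edge he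
    simp only [hK.t_eq_of_edge he, Function.iterate_succ_apply, h2]
  have h3 : (K.ops i).t y = (K.ops i).t x := by
    omega
  have h4 : K.t i y = K.t i x := Int.ofNat.inj h3
  simp only [h4] at h2
  exact (hl.eq_of_iterate_e h3 rfl h2).symm

/-- relations between the loci and deviations of a self-complementary
vertex `v` of a symmetric `A_3`-crystal: (i) `b = (a_3, a_2, a_1)`; (ii) `K^low[b]` is the
`σ`-image of `K^up[a]`; (iii) `D_1 = -D_2 = N_3 = -N_2`; (iv) `v^up[a|D] = v^low[b|N]`. -/
theorem A3_selfcomplementary_relations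
    (K : PreGraph) (hK : IsACrystal 3 K)
    (s : K.V) (hs : IsSource K s)
    (c : ℕ → ℕ) (hc : ∀ i, 1 ≤ i → i ≤ 3 → K.h i s = c i) (hsym : c 3 = c 1)
    (σ : K.V → K.V) (hσb : Function.Bijective σ)
    (hσ : ∀ (i : ℕ) (u v : K.V), K.F i u = some v ↔ K.F (4 - i) (σ u) = some (σ v))
    (v : K.V) (hv : σ v = v)
    (a : ℕ → ℕ) (ha : ∀ i, 1 ≤ i → i ≤ 3 → a i ≤ c i)
    (pa : K.V) (hpa : IsPrin K 0 3 s a pa) (hva : inComp K (Set.Icc 1 2) pa v)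
    (b : ℕ → ℕ) (hb : ∀ i, 1 ≤ i → i ≤ 3 → b i ≤ c i)
    (pb : K.V) (hpb : IsPrin K 0 3 s b pb) (hvb : inComp K (Set.Icc 2 3) pb v)
    (D : ℕ → ℤ) (hD1 : 0 ≤ (a 2 : ℤ) + D 1) (hD2 : 0 ≤ (a 3 : ℤ) + D 2)
    (s' : (K.sub (Set.Icc 1 2) pa).V) (hs' : IsSource (K.sub (Set.Icc 1 2) pa) s')
    (z : (K.sub (Set.Icc 1 2) pa).V)
    (hz : IsPrin (K.sub (Set.Icc 1 2) pa) 0 2 s' (fun i => ((a (i + 1) : ℤ) + D i).toNat) z)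
    (hzv : inComp K ({2} : Set ℕ) v z.1)
    (N : ℕ → ℤ) (hN2 : 0 ≤ (b 1 : ℤ) + N 2) (hN3 : 0 ≤ (b 2 : ℤ) + N 3)
    (s'' : (K.sub (Set.Icc 2 3) pb).V) (hs'' : IsSource (K.sub (Set.Icc 2 3) pb) s'')
    (z' : (K.sub (Set.Icc 2 3) pb).V)
    (hz' : IsPrin (K.sub (Set.Icc 2 3) pb) 1 2 s''
      (fun i => ((b (i - 1) : ℤ) + N i).toNat) z')
    (hzv' : inComp K ({2} : Set ℕ) v z'.1) :
    (b 1 = a 3 ∧ b 2 = a 2 ∧ b 3 = a 1) ∧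
    ({u | inComp K (Set.Icc 2 3) pb u} = σ '' {u | inComp K (Set.Icc 1 2) pa u}) ∧
    (D 1 = - D 2 ∧ D 1 = N 3 ∧ N 3 = - N 2) ∧
    z.1 = z'.1 := by
  have hcol := hK.1
  have T := hK.triple
  have Pup : ColorOps.Pair (K.ops (0 + 1)) (K.ops (0 + 2)) := T.AB
  have Plow : ColorOps.Pair (K.ops (1 + 1)) (K.ops (1 + 2)) := T.CB.swap
  have m1 : 1 ∈ Set.Icc 1 2 := by simp
  have m2 : 2 ∈ Set.Icc 1 2 := by simp
  have m2' : 2 ∈ Set.Icc 2 3 := by simp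
  have m3 : 3 ∈ Set.Icc 2 3 := by simp
  have Wup : ColorOps.Verma (K.ops 1).dual (K.ops 2).dual :=
    hcol.verma_dual (hK.2.2.2.1 1 (by simp) 2 (by simp) (.inl rfl)).2
  have Wlow : ColorOps.Verma (K.ops 2).dual (K.ops 3).dual :=
    hcol.verma_dual (hK.2.2.2.1 2 (by simp) 3 (by simp) (.inl rfl)).2
  have c1 := hc 1 (by simp) (by simp)
  have c2 := hc 2 (by simp) (by simp)
  have c3 := hc 3 (by simp) (by simp)
  obtain ⟨Ba, a1, a2, a3, a4, a5, a6⟩ := hK.biCrit_of_isPrin hs hpa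
  obtain ⟨Bb, b1, b2, b3, b4, b5, b6⟩ := hK.biCrit_of_isPrin hs hpb
  -- the source of the upper component
  have s1 := hcol.t_eq_zero_of_sub hs' m1
  have s2 := hcol.t_eq_zero_of_sub hs' m2
  obtain ⟨m, hm, m4, m5, m6, m7⟩ := T.AB.exists_source_of_crit (inComp K (Set.Icc 1 2) pa)
    (fun _ => hcol.inComp_e m1) (fun _ => hcol.inComp_e m2) .refl Ba.critA
  obtain rfl : s'.1 = m := hcol.source_unique T.AB Wup (fun k hk => by
    rw [Set.mem_Icc] at hk; omega) (s'.2.symm.trans hm) s1 s2 m4 m5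
  -- the source of the lower component
  have r2 := hcol.t_eq_zero_of_sub hs'' m2'
  have r3 := hcol.t_eq_zero_of_sub hs'' m3
  obtain ⟨n, hn, n4, n5, n6, n7⟩ := T.CB.swap.exists_source_of_crit
    (inComp K (Set.Icc 2 3) pb) (fun _ => hcol.inComp_e m2') (fun _ => hcol.inComp_e m3) .refl
    Bb.critC.swap
  have lower : ∀ k ∈ Set.Icc 2 3, k = 2 ∨ k = 3 := fun k hk => by
    rw [Set.mem_Icc] at hk; omega
  obtain rfl : s''.1 = n :=
    hcol.source_unique T.CB.swap Wlow lower (s''.2.symm.trans hn) r2 r3 n4 n5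
  -- the involution
  have hup : ∀ u, inComp K (Set.Icc 2 3) pb (σ u) ↔ inComp K (Set.Icc 1 2) pa u := by
    intro u
    rw [show inComp K (Set.Icc 1 2) pa u ↔ inComp K (Set.Icc 1 2) v u from
      ⟨hva.symm.trans, hva.trans⟩, ← inComp_involution hσb hσ, hv]
    exact ⟨hvb.symm.trans, hvb.trans⟩
  have i1 := hcol.h_involution hσb hσ 1
  have i2 := hcol.h_involution hσb hσ 2
  have i3 := hcol.t_involution hσb hσ 1
  have i4 := hcol.t_involution hσb hσ 2
  have hss : s''.1 = σ s'.1 := hcol.source_unique T.CB.swap Wlow lower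
    (s''.2.symm.trans ((hup _).mpr s'.2)) r2 r3 ((i4 _).trans s2) ((i3 _).trans s1)
  have e1 : (K.ops 3).h s''.1 = (K.ops 1).h s'.1 := by rw [hss]; exact i1 _
  have e2 : (K.ops 2).h s''.1 = (K.ops 2).h s'.1 := by rw [hss]; exact i2 _
  have v1 : (K.ops 3).h v = (K.ops 1).h v := by simpa [hv] using i1 v
  have v3 : (K.ops 3).t v = (K.ops 1).t v := by simpa [hv] using i3 v
  have g1 := hK.charge_upper hva
  have g2 := hK.charge_lower hvb
  have g3 := hK.charge_upper z.2
  have g4 := hK.charge_lower z'.2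
  have g5 := hK.weight_sub_middle hzv
  have g6 := hK.weight_sub_middle hzv'
  unfold ColorOps.charge at g1 g2 g3 g4
  have z1 := hcol.ops_of_prinStr_two Pup s1 s2 (applyStr_of_sub hz)
  have z2 := hcol.ops_of_prinStr_two Plow r2 r3 (applyStr_of_sub hz')
  norm_num [Int.toNat_of_nonneg, hD1, hD2, hN2, hN3] at z1 z2
  obtain ⟨p1, p2, p3, p4⟩ := z1
  obtain ⟨q1, q2, q3, q4⟩ := z2
  have hD : D 1 + D 2 = 0 := by linarith
  have hN : N 2 + N 3 = 0 := by linarith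
  have hsum : (a 1 : ℤ) + a 2 + a 3 = b 1 + b 2 + b 3 := by linarith
  clear g1 g2 g3 g4 g5 g6
  have hab : b 1 = a 3 ∧ b 2 = a 2 ∧ b 3 = a 1 := by omega
  have hz2 : (K.ops 2).h z.1 - (K.ops 2).t z.1 = (K.ops 2).h z'.1 - (K.ops 2).t z'.1 := by omega
  have hzz : z.1 = z'.1 := hcol.eq_of_inComp_line (hzv.symm.trans hzv') hz2
  refine ⟨hab, ?_, ?_, hzz⟩
  · ext u
    obtain ⟨u, rfl⟩ := hσb.2 u
    simp only [Set.mem_ofPred_eq, hup, hσb.1.mem_set_image]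
  · have hzt : (K.ops 2).t z.1 = (K.ops 2).t z'.1 := by rw [hzz]
    omega
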